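/- arXiv:2104.09312 — 7 statements merged into one kernel-verified Lean document; each statement's English description precedes it below -/
import Mathlib

section
/- Let G̃ = (Ṽ, Ẽ) be a finite simple graph with |Ṽ| = n, and let d(v) denote the degree of vertex v in G̃. Then for every bijection f from Ṽ onto {1, 2, …, n}: Σ_{v∈Ṽ} (n − d(v))·f(v) + Σ_{{u,v}∈Ẽ} 2·max(f(u), f(v)) = n²(n+1)/2 + Σ_{{u,v}∈Ẽ} |f(u) − f(v)|. -/
/-- Weighted handshake lemma: summing `g` over all vertices with multiplicity the degree is the
same as summing `g` over the endpoints of every edge. -/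
theorem SimpleGraph.sum_degree_nsmul {V M : Type*} [Fintype V] [DecidableEq V] [AddCommMonoid M]
    (G : SimpleGraph V) [DecidableRel G.Adj] (g : V → M) :
    ∑ v, G.degree v • g v = ∑ e ∈ G.edgeFinset, ∑ v ∈ e.toFinset, g v := by
  have h (v : V) : G.degree v • g v = ∑ e ∈ G.edgeFinset with v ∈ e, g v := by
    rw [Finset.sum_const, ← G.incidenceFinset_eq_filter, G.card_incidenceFinset_eq_degree]
  simp_rw [h]
  exact Finset.sum_comm' (by simp [and_comm])

/-- Twice the sum of `f v + 1` over a bijection `f` onto `Fin n` is `n * (n + 1)`. -/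
theorem two_mul_sum_equiv_fin_add_one {V : Type*} [Fintype V] {n : ℕ} (f : V ≃ Fin n) :
    2 * ∑ v, (((f v : ℕ) : ℤ) + 1) = (n : ℤ) * (n + 1) := by
  rw [Equiv.sum_comp f fun i : Fin n => ((i : ℕ) : ℤ) + 1,
    Fin.sum_univ_eq_sum_range fun i : ℕ => (i : ℤ) + 1]
  clear f
  induction n with
  | zero => simp
  | succ k ih =>
    rw [Finset.sum_range_succ, mul_add, ih]
    push_cast
    ring

/-- For a finite simple graph `G` on `n` vertices with degrees `d v`, and any
bijection `f : V ≃ Fin n` (with values interpreted as `1,…,n` via `(f v) + 1`),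
`∑_v (n − d v)·f v + ∑_{{u,v}∈E} 2·max (f u) (f v)
  = n²(n+1)/2 + ∑_{{u,v}∈E} |f u − f v|`. -/
theorem stmt0 (V : Type) [Fintype V] [DecidableEq V]
    (G : SimpleGraph V) [DecidableRel G.Adj]
    (f : V ≃ Fin (Fintype.card V)) :
    (∑ v : V, ((Fintype.card V : ℤ) - (G.degree v : ℤ)) * (((f v : ℕ) : ℤ) + 1))
      + ∑ e ∈ G.edgeFinset,
          Sym2.lift ⟨fun u v => 2 * max (((f u : ℕ) : ℤ) + 1) (((f v : ℕ) : ℤ) + 1),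
            fun u v => by simp [max_comm]⟩ e
    = ((Fintype.card V : ℤ) ^ 2 * ((Fintype.card V : ℤ) + 1)) / 2
      + ∑ e ∈ G.edgeFinset,
          Sym2.lift ⟨fun u v => |(((f u : ℕ) : ℤ) + 1) - (((f v : ℕ) : ℤ) + 1)|,
            fun u v => by simp [abs_sub_comm]⟩ e := by
  have hsum : (Fintype.card V : ℤ) ^ 2 * ((Fintype.card V : ℤ) + 1) / 2
      = Fintype.card V * ∑ v, (((f v : ℕ) : ℤ) + 1) :=
    Int.ediv_eq_of_eq_mul_right two_ne_zero (by
      linear_combination -(Fintype.card V : ℤ) * two_mul_sum_equiv_fin_add_one f)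
  have hdeg := G.sum_degree_nsmul fun v => ((f v : ℕ) : ℤ) + 1
  simp only [nsmul_eq_mul] at hdeg
  simp only [sub_mul, Finset.sum_sub_distrib]
  rw [hsum, Finset.mul_sum, hdeg, sub_add, sub_eq_add_neg, neg_sub, ← Finset.sum_sub_distrib]
  congr 1
  refine Finset.sum_congr rfl fun e he => ?_
  induction e with | h u v =>
  have huv : u ≠ v := (SimpleGraph.mem_edgeFinset.mp he : G.Adj u v).ne
  rw [Sym2.toFinset_mk_eq, Finset.sum_pair huv]
  simp only [Sym2.lift_mk]
  grind
end

section
/- Let G̃ = (Ṽ, Ẽ) be a finite simple graph with |Ṽ| = n and degrees d(v), and let K be a positive integer. Then there exists a bijection f : Ṽ → {1, …, n} with Σ_{v∈Ṽ} (n − d(v))·f(v) + Σ_{{u,v}∈Ẽ} 2·max(f(u), f(v)) ≤ n²(n+1)/2 + K if and only if there exists a bijection f : Ṽ → {1, …, n} with Σ_{{u,v}∈Ẽ} |f(u) − f(v)| ≤ K. Equivalently, the minimum over all bijections f of Σ_{v} (n − d(v))·f(v) + Σ_{{u,v}∈Ẽ} 2·max(f(u), f(v)) equals n²(n+1)/2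 plus the minimum over all bijections f of Σ_{{u,v}∈Ẽ} |f(u) − f(v)|. -/
/-- The total weighted connection time of the star instance built from graph `G`:
weights `n − d v` on pairs `{o,v}` (connecting at time `f v`) and weight `2` on
pairs `{u,v}` for edges `{u,v}` of `G` (connecting at time `max (f u) (f v)`). -/
def starCost {V : Type} [Fintype V] [DecidableEq V]
    (G : SimpleGraph V) [DecidableRel G.Adj] (f : V ≃ Fin (Fintype.card V)) : ℤ :=
  (∑ v : V, ((Fintype.card V : ℤ) - (G.degree v : ℤ)) * (((f v : ℕ) : ℤ) + 1))
    + ∑ e ∈ G.edgeFinset,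
        Sym2.lift ⟨fun u v => 2 * max (((f u : ℕ) : ℤ) + 1) (((f v : ℕ) : ℤ) + 1),
          fun u v => by simp [max_comm]⟩ e

/-- The optimal-linear-arrangement cost `∑_{{u,v}∈E} |f u − f v|` of a bijection `f`. -/
def olaCost {V : Type} [Fintype V] [DecidableEq V]
    (G : SimpleGraph V) [DecidableRel G.Adj] (f : V ≃ Fin (Fintype.card V)) : ℤ :=
  ∑ e ∈ G.edgeFinset,
      Sym2.lift ⟨fun u v => |(((f u : ℕ) : ℤ) + 1) - (((f v : ℕ) : ℤ) + 1)|,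
        fun u v => by simp [abs_sub_comm]⟩ e

/-- Weighted handshake lemma: `∑ v, deg v * g v = ∑_{uv ∈ E} (g u + g v)`. -/
theorem sum_degree_mul_eq_sum_edgeFinset {V R : Type*} [Fintype V] [DecidableEq V]
    [CommSemiring R] (G : SimpleGraph V) [DecidableRel G.Adj] (g : V → R) :
    ∑ v, (G.degree v : R) * g v
      = ∑ e ∈ G.edgeFinset, Sym2.lift ⟨fun u v => g u + g v, fun _ _ => add_comm _ _⟩ e := by
  have h (v : V) : (G.degree v : R) * g v
      = ∑ e ∈ G.edgeFinset, if v ∈ e then g v else 0 := by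
    rw [← Finset.sum_filter, ← G.incidenceFinset_eq_filter, Finset.sum_const,
      G.card_incidenceFinset_eq_degree, nsmul_eq_mul]
  simp_rw [h]
  rw [Finset.sum_comm]
  refine Finset.sum_congr rfl fun e he => ?_
  induction e with
  | _ u v =>
    have huv : u ≠ v := (SimpleGraph.mem_edgeFinset.mp he).ne
    have hfilter : Finset.univ.filter (fun w => w ∈ s(u, v)) = {u, v} := by
      ext w
      simp
    rw [← Finset.sum_filter, hfilter, Finset.sum_pair huv, Sym2.lift_mk]

theorem sum_equivFin_add_one {V : Type*} [Fintype V] (f : V ≃ Fin (Fintype.card V)) :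
    2 * ∑ v, (((f v : ℕ) : ℤ) + 1) = (Fintype.card V : ℤ) * ((Fintype.card V : ℤ) + 1) := by
  rw [f.sum_comp (fun i => ((i : ℕ) : ℤ) + 1),
    Fin.sum_univ_eq_sum_range (fun i => (i : ℤ) + 1)]
  generalize Fintype.card V = n
  induction n with
  | zero => simp
  | succ n ih =>
    rw [Finset.sum_range_succ, mul_add, ih]
    push_cast
    ring

theorem starCost_eq_add_olaCost {V : Type} [Fintype V] [DecidableEq V]
    (G : SimpleGraph V) [DecidableRel G.Adj] (f : V ≃ Fin (Fintype.card V)) :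
    starCost G f
      = (Fintype.card V : ℤ) ^ 2 * ((Fintype.card V : ℤ) + 1) / 2 + olaCost G f := by
  have hconst : (Fintype.card V : ℤ) ^ 2 * ((Fintype.card V : ℤ) + 1) / 2
      = (Fintype.card V : ℤ) * ∑ v, (((f v : ℕ) : ℤ) + 1) := by
    refine Int.ediv_eq_of_eq_mul_right two_ne_zero ?_
    linear_combination -(Fintype.card V : ℤ) * sum_equivFin_add_one f
  have hedge : ∑ e ∈ G.edgeFinset,
        Sym2.lift ⟨fun u v => 2 * max (((f u : ℕ) : ℤ) + 1) (((f v : ℕ) : ℤ) + 1),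
          fun u v => by simp [max_comm]⟩ e
      = olaCost G f + ∑ v, (G.degree v : ℤ) * (((f v : ℕ) : ℤ) + 1) := by
    rw [sum_degree_mul_eq_sum_edgeFinset, olaCost, ← Finset.sum_add_distrib]
    refine Finset.sum_congr rfl fun e _ => ?_
    induction e with
    | _ u v =>
      simp only [Sym2.lift_mk]
      grind
  rw [starCost, hedge, hconst]
  simp_rw [sub_mul]
  rw [Finset.sum_sub_distrib, Finset.mul_sum]
  ring

/-- there is a bijection `f` with star cost `≤ n²(n+1)/2 + K` iff there is a
bijection with linear-arrangement cost `≤ K`; equivalently, the minimum star cost equals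
`n²(n+1)/2` plus the minimum linear-arrangement cost. -/
theorem stmt1 (V : Type) [Fintype V] [DecidableEq V]
    (G : SimpleGraph V) [DecidableRel G.Adj] (K : ℤ) (hK : 0 < K) :
    ((∃ f : V ≃ Fin (Fintype.card V),
        starCost G f ≤ (Fintype.card V : ℤ) ^ 2 * ((Fintype.card V : ℤ) + 1) / 2 + K)
      ↔ (∃ f : V ≃ Fin (Fintype.card V), olaCost G f ≤ K))
    ∧ (Finset.univ.image (starCost G)).min'
          ((Finset.univ_nonempty_iff.mpr ⟨Fintype.equivFin V⟩).image (starCost G))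
        = (Fintype.card V : ℤ) ^ 2 * ((Fintype.card V : ℤ) + 1) / 2
          + (Finset.univ.image (olaCost G)).min'
              ((Finset.univ_nonempty_iff.mpr ⟨Fintype.equivFin V⟩).image (olaCost G)) := by
  simp only [starCost_eq_add_olaCost, add_le_add_iff_left, true_and]
  refine le_antisymm ?_ ?_
  · obtain ⟨f, -, hf⟩ := Finset.mem_image.mp (Finset.min'_mem (Finset.univ.image (olaCost G))
      ((Finset.univ_nonempty_iff.mpr ⟨Fintype.equivFin V⟩).image (olaCost G)))
    rw [← hf, ← starCost_eq_add_olaCost]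
    exact Finset.min'_le _ _ (Finset.mem_image_of_mem _ (Finset.mem_univ f))
  · refine Finset.le_min' _ _ _ fun y hy => ?_
    obtain ⟨f, -, rfl⟩ := Finset.mem_image.mp hy
    rw [starCost_eq_add_olaCost]
    gcongr
    exact Finset.min'_le _ _ (Finset.mem_image_of_mem _ (Finset.mem_univ f))
end

section
/- Let jobs 1, …, N have processing times p_i > 0 and weights w_i ≥ 0 (real). Let 0 = i_0 < i_1 < … < i_k = N be the density decomposition breakpoints, where for each j ≥ 1, i_j is the largest index b > i_{j−1} maximizing the density (Σ_{i_{j−1} < i ≤ b} w_i)/(Σ_{i_{j−1} < i ≤ b} p_i). Then the densities of the consecutive blocks are strictly decreasing: for each j, the density of (i_{j−1}, i_j] is strictly greater than the density of (i_j, i_{j+1}]. -/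
/-- The density of the block `(a, b]` of jobs `a+1, …, b`: total weight divided by total
processing time. -/
noncomputable def blockDensity (p w : ℕ → ℝ) (a b : ℕ) : ℝ :=
  (∑ i ∈ Finset.Ioc a b, w i) / (∑ i ∈ Finset.Ioc a b, p i)

theorem sum_Ioc_pos_of_le {p : ℕ → ℝ} {N a b : ℕ} (hp : ∀ i, 1 ≤ i → i ≤ N → 0 < p i)
    (hab : a < b) (hb : b ≤ N) : 0 < ∑ i ∈ Finset.Ioc a b, p i := by
  refine Finset.sum_pos (fun i hi => ?_) (Finset.nonempty_Ioc.2 hab)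
  rw [Finset.mem_Ioc] at hi
  exact hp i (by omega) (by omega)

/-- If extending the block `(a, b]` to `(a, c]` strictly lowers the density, then the added
block `(b, c]` has density strictly below that of `(a, b]`. -/
theorem blockDensity_lt_of_extend_lt {p w : ℕ → ℝ} {N a b c : ℕ}
    (hp : ∀ i, 1 ≤ i → i ≤ N → 0 < p i) (hab : a < b) (hbc : b < c) (hc : c ≤ N)
    (h : blockDensity p w a c < blockDensity p w a b) :
    blockDensity p w b c < blockDensity p w a b := by
  have h₁ := sum_Ioc_pos_of_le hp hab (hbc.le.trans hc)
  have h₂ := sum_Ioc_pos_of_le hp hbc hc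
  unfold blockDensity at h ⊢
  rw [← Finset.sum_Ioc_consecutive w hab.le hbc.le, ← Finset.sum_Ioc_consecutive p hab.le hbc.le,
    div_lt_div_iff₀ (add_pos h₁ h₂) h₁] at h
  rw [div_lt_div_iff₀ h₂ h₁]
  linarith

/-- if `0 = bp 0 < bp 1 < … < bp k = N` are the density-decomposition
breakpoints (each `bp (j+1)` is the largest `b > bp j` maximizing the density of
`(bp j, b]`), then the densities of consecutive blocks strictly decrease. -/
theorem stmt6 (N k : ℕ) (p w : ℕ → ℝ)
    (hp : ∀ i, 1 ≤ i → i ≤ N → 0 < p i) (hw : ∀ i, 1 ≤ i → i ≤ N → 0 ≤ w i)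
    (bp : ℕ → ℕ) (h0 : bp 0 = 0) (hk : bp k = N)
    (hmono : ∀ j < k, bp j < bp (j + 1))
    (hmax : ∀ j < k, ∀ b, bp j < b → b ≤ N →
        blockDensity p w (bp j) b ≤ blockDensity p w (bp j) (bp (j + 1)))
    (hlargest : ∀ j < k, ∀ b, bp j < b → b ≤ N →
        blockDensity p w (bp j) b = blockDensity p w (bp j) (bp (j + 1)) → b ≤ bp (j + 1)) :
    ∀ j, j + 1 < k →
      blockDensity p w (bp (j + 1)) (bp (j + 2)) < blockDensity p w (bp j) (bp (j + 1)) := by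
  intro j hj
  have hle : bp (j + 2) ≤ N := by
    have hbound : ∀ m i, i + m = k → bp i ≤ N := by
      intro m
      induction m with
      | zero => rintro i rfl; exact hk.le
      | succ m ih =>
        intro i hi
        exact (hmono i (by omega)).le.trans (ih (i + 1) (by omega))
    exact hbound (k - (j + 2)) (j + 2) (by omega)
  have hab := hmono j (by omega)
  have hbc := hmono (j + 1) hj
  refine blockDensity_lt_of_extend_lt hp hab hbc hle
    (lt_of_le_of_ne (hmax j (by omega) _ (hab.trans hbc) hle) fun heq => ?_)
  exact hbc.not_ge (hlargest j (by omega) _ (hab.trans hbc) hle heq)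
end

section
/- Let jobs 1, …, N have processing times p_i > 0 and weights w_i ≥ 0 (real), and set x_m = Σ_{i≤m} p_i and y_m = Σ_{i≤m} w_i for m = 0, 1, …, N (so x_0 = y_0 = 0). Let 0 = i_0 < i_1 < … < i_k = N be the density decomposition breakpoints, where for each j ≥ 1, i_j is the largest index b > i_{j−1} maximizing (y_b − y_{i_{j−1}})/(x_b − x_{i_{j−1}}). Then for every m ∈ {1, …, N}: m ∈ {i_1, …, i_k} if and only if there exists λ ∈ ℝ such that y_j − λ·x_j < y_m − λ·x_m for every j ∈ {0, 1, …, N} with j ≠ m; that is, the breakpoints of the density decomposition are exactly the indices whose prefix-sum points (x_m, y_m) are vertices of the upper boundary of the convex hull of the points (x_j, y_j), j = 0, …, N. -/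
/-- Prefix sum `∑_{i ≤ m} f i` of the values `f 1, …, f m` (so the prefix sum at `0` is
`0`). -/
noncomputable def prefixSum (f : ℕ → ℝ) (m : ℕ) : ℝ := ∑ i ∈ Finset.Icc 1 m, f i

theorem sum_Ioc_eq_prefixSum_sub (f : ℕ → ℝ) {a b : ℕ} (hab : a ≤ b) :
    ∑ i ∈ Finset.Ioc a b, f i = prefixSum f b - prefixSum f a := by
  have h : ∀ m, prefixSum f m = ∑ i ∈ Finset.Ioc 0 m, f i := fun m => rfl
  rw [h, h, ← Finset.sum_Ioc_consecutive f (Nat.zero_le a) hab]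
  ring

theorem prefixSum_lt_prefixSum {N : ℕ} {p : ℕ → ℝ} (hp : ∀ i, 1 ≤ i → i ≤ N → 0 < p i)
    {a b : ℕ} (hab : a < b) (hb : b ≤ N) : prefixSum p a < prefixSum p b := by
  have h : 0 < ∑ i ∈ Finset.Ioc a b, p i := by
    refine Finset.sum_pos (fun i hi => ?_) ⟨b, Finset.mem_Ioc.2 ⟨hab, le_rfl⟩⟩
    rw [Finset.mem_Ioc] at hi
    exact hp i (by omega) (by omega)
  rw [sum_Ioc_eq_prefixSum_sub p hab.le] at h
  linarith

theorem blockDensity_mul_sub {N : ℕ} {p : ℕ → ℝ} (hp : ∀ i, 1 ≤ i → i ≤ N → 0 < p i)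
    (w : ℕ → ℝ) {a b : ℕ} (hab : a < b) (hb : b ≤ N) :
    blockDensity p w a b * (prefixSum p b - prefixSum p a) = prefixSum w b - prefixSum w a := by
  have h := prefixSum_lt_prefixSum hp hab hb
  rw [blockDensity, sum_Ioc_eq_prefixSum_sub p hab.le, sum_Ioc_eq_prefixSum_sub w hab.le]
  exact div_mul_cancel₀ _ (by linarith)

/-- A sequence that starts below `m` and reaches `m` by step `k` either hits `m` or jumps over it. -/
theorem exists_eq_or_lt_lt_succ (f : ℕ → ℕ) {m k : ℕ} (h0 : f 0 < m) (hk : m ≤ f k) :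
    (∃ j, 1 ≤ j ∧ j ≤ k ∧ f j = m) ∨ ∃ j < k, f j < m ∧ m < f (j + 1) := by
  induction k with
  | zero => omega
  | succ k ih =>
    by_cases h : m ≤ f k
    · rcases ih h with ⟨j, h1, h2, h3⟩ | ⟨j, h1, h2⟩
      · exact Or.inl ⟨j, h1, by omega, h3⟩
      · exact Or.inr ⟨j, by omega, h2⟩
    · rcases hk.eq_or_lt with h' | h'
      · exact Or.inl ⟨k + 1, by omega, le_rfl, h'.symm⟩
      · exact Or.inr ⟨k, by omega, by omega, h'⟩

/-- with prefix sums `x_m = ∑_{i≤m} p i`, `y_m = ∑_{i≤m} w i`, an index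
`m ∈ {1,…,N}` is a breakpoint of the density decomposition iff the point `(x_m, y_m)` is a
vertex of the upper boundary of the convex hull of the points `(x_j, y_j)`, `j = 0,…,N`,
i.e. iff some line of slope `λ` passes through `(x_m, y_m)` strictly above all the other
points. -/
theorem stmt7 (N k : ℕ) (p w : ℕ → ℝ)
    (hp : ∀ i, 1 ≤ i → i ≤ N → 0 < p i) (hw : ∀ i, 1 ≤ i → i ≤ N → 0 ≤ w i)
    (bp : ℕ → ℕ) (h0 : bp 0 = 0) (hk : bp k = N)
    (hmono : ∀ j < k, bp j < bp (j + 1))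
    (hmax : ∀ j < k, ∀ b, bp j < b → b ≤ N →
        blockDensity p w (bp j) b ≤ blockDensity p w (bp j) (bp (j + 1)))
    (hlargest : ∀ j < k, ∀ b, bp j < b → b ≤ N →
        blockDensity p w (bp j) b = blockDensity p w (bp j) (bp (j + 1)) → b ≤ bp (j + 1)) :
    ∀ m, 1 ≤ m → m ≤ N →
      ((∃ j, 1 ≤ j ∧ j ≤ k ∧ bp j = m) ↔
        ∃ lam : ℝ, ∀ j ≤ N, j ≠ m →
          prefixSum w j - lam * prefixSum p j < prefixSum w m - lam * prefixSum p m) := by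
  have hle : ∀ j ≤ k, bp j ≤ N := by
    intro j hj
    induction hj using Nat.decreasingInduction with
    | self => exact hk.le
    | of_succ j hj ih => exact (hmono j hj).le.trans ih
  set x := prefixSum p with hx
  set y := prefixSum w with hy
  have hlt : ∀ {a b}, a < b → b ≤ N → x a < x b := fun h h' => prefixSum_lt_prefixSum hp h h'
  obtain ⟨s, hs⟩ : ∃ s : ℕ → ℝ, ∀ j, s j = blockDensity p w (bp j) (bp (j + 1)) :=
    ⟨_, fun _ => rfl⟩
  have hblock : ∀ j < k, s j * (x (bp (j + 1)) - x (bp j)) = y (bp (j + 1)) - y (bp j) := by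
    intro j hj
    rw [hs]
    exact blockDensity_mul_sub hp w (hmono j hj) (hle _ hj)
  have hbelow : ∀ j < k, ∀ b, bp j ≤ b → b ≤ N → y b - y (bp j) ≤ s j * (x b - x (bp j)) := by
    intro j hj b hb hbN
    rcases hb.eq_or_lt with rfl | hb
    · simp
    · rw [← blockDensity_mul_sub hp w hb hbN, hs]
      exact mul_le_mul_of_nonneg_right (hmax j hj b hb hbN) (sub_nonneg.2 (hlt hb hbN).le)
  have hanti : ∀ j, j + 1 < k → s (j + 1) < s j := by
    intro j hj
    have h1 := hmono j (by omega)
    have h2 := hmono (j + 1) hj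
    have hN := hle (j + 1 + 1) hj
    have h3 : blockDensity p w (bp j) (bp (j + 1 + 1)) < s j := by
      rw [hs]
      refine lt_of_le_of_ne (hmax j (by omega) _ (by omega) hN) fun h => ?_
      have := hlargest j (by omega) _ (by omega) hN h
      omega
    have h4 := mul_lt_mul_of_pos_right h3 (sub_pos.2 (hlt (h1.trans h2) hN))
    rw [hx, blockDensity_mul_sub hp w (h1.trans h2) hN, ← hx, ← hy] at h4
    have h5 := hblock j (by omega)
    have h6 := hblock (j + 1) hj
    have h7 := hlt h2 hN
    by_contra! h
    nlinarith [mul_le_mul_of_nonneg_right h (sub_pos.2 h7).le]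
  have hleft : ∀ j < k, ∀ b, b ≤ bp (j + 1) →
      s j * (x (bp (j + 1)) - x b) ≤ y (bp (j + 1)) - y b := by
    intro j
    induction j with
    | zero =>
      intro hj b hb
      have h1 := hblock 0 hj
      have h2 := hbelow 0 hj b (by omega) (hb.trans (hle _ hj))
      linarith
    | succ j ih =>
      intro hj b hb
      have h1 := hblock (j + 1) hj
      rcases le_or_gt (bp (j + 1)) b with hb' | hb'
      · have h2 := hbelow (j + 1) hj b hb' (hb.trans (hle _ hj))
        linarith
      · have h2 := ih (by omega) b hb'.le
        have h3 := mul_le_mul_of_nonneg_right (hanti j hj).le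
          (sub_pos.2 (hlt hb' (hle (j + 1) hj.le))).le
        linarith
  intro m hm1 hmN
  constructor
  · rintro ⟨j, hj1, hjk, rfl⟩
    obtain ⟨i, rfl⟩ : ∃ i, j = i + 1 := ⟨j - 1, by omega⟩
    obtain ⟨lam, hlam, hlam'⟩ : ∃ lam < s i, i + 1 < k → s (i + 1) < lam := by
      by_cases h : i + 1 < k
      · obtain ⟨lam, h1, h2⟩ := exists_between (hanti i h)
        exact ⟨lam, h2, fun _ => h1⟩
      · exact ⟨s i - 1, by linarith, fun h' => absurd h' h⟩
    refine ⟨lam, fun b hb hne => ?_⟩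
    rcases lt_or_gt_of_ne hne with h | h
    · have h1 := hleft i hjk b h.le
      have h2 := mul_lt_mul_of_pos_right hlam (sub_pos.2 (hlt h hmN))
      linarith
    · have hik : i + 1 < k := lt_of_le_of_ne hjk fun h' => by
        rw [h', hk] at h
        omega
      have h1 := hbelow (i + 1) hik b h.le hb
      have h2 := mul_lt_mul_of_pos_right (hlam' hik) (sub_pos.2 (hlt h hb))
      linarith
  · rintro ⟨lam, hlam⟩
    refine (exists_eq_or_lt_lt_succ bp (by omega) (by omega)).resolve_right ?_
    rintro ⟨j, hj, h1, h2⟩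
    have hN := hle (j + 1) hj
    have h3 := hlam (bp j) (by omega) h1.ne
    have h4 := hlam (bp (j + 1)) hN h2.ne'
    have h5 := hbelow j hj m h1.le hmN
    have h6 := hleft j hj m h2.le
    have h7 : lam < s j :=
      lt_of_mul_lt_mul_right (by linarith) (sub_pos.2 (hlt h1 hmN)).le
    have h8 : s j < lam :=
      lt_of_mul_lt_mul_right (by linarith) (sub_pos.2 (hlt h2 hN)).le
    exact lt_asymm h7 h8
end

section
/- Let G = (V, E) be a finite connected simple graph with edge lengths c(e) > 0, and let {v_1,u_1}, …, {v_r,u_r} be relevant pairs of distinct vertices with weights w_1, …, w_r > 0. Let Ĝ be the metric closure of G: the complete graph on V in which the length of edge {u,v} is the shortest-path distance d_G(u,v), the minimum over u–v paths in G of the sum of edge lengths. For a linear ordering L of the edge set of G (respectively of Ĝ), let t_i(L) be the sum of the lengths of the edges in the shortest prefix of L whose edges connect v_i and u_i, and let Z(L) = Σ_{i=1}^r w_i·t_i(L). Then the minimum of Z(L) over all linear orderings L of E equals the minimum of Z(L̂) over all linear orderings L̂ of the edge set of Ĝ. -/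
/-- The connection time of the vertices `u, v` under the schedule `L` (a list of edges,
each constructed at unit speed, edge `e` taking time `c e`): the total length of the
shortest prefix of `L` whose edges connect `u` and `v`. -/
noncomputable def connTime {V : Type} (c : Sym2 V → ℝ) (L : List (Sym2 V)) (u v : V) : ℝ :=
  ((L.take (sInf {k : ℕ |
      (SimpleGraph.fromEdgeSet {e | e ∈ L.take k}).Reachable u v})).map c).sum

/-- The total weighted connection time `∑ i, w i * t_i(L)` of the relevant pairs
`pair i = (v_i, u_i)` under the schedule `L`. -/
noncomputable def totalCost {V : Type} {r : ℕ} (c : Sym2 V → ℝ) (w : Fin r → ℝ)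
    (pair : Fin r → V × V) (L : List (Sym2 V)) : ℝ :=
  ∑ i : Fin r, w i * connTime c L (pair i).1 (pair i).2

/-- `L` is a linear ordering (schedule) of the edge set `s`: a duplicate-free list whose
elements are exactly the members of `s`. -/
def IsOrdering {α : Type} (L : List α) (s : Set α) : Prop :=
  L.Nodup ∧ ∀ e, e ∈ L ↔ e ∈ s

/-- The length of an edge of the metric closure of `G`: for `e = s(u,v)`, the
shortest-path distance in `G` between `u` and `v`, i.e. the infimum over `u`–`v` walks in
`G` of the total length of their edges. -/
noncomputable def mcLength {V : Type} (G : SimpleGraph V) (c : Sym2 V → ℝ)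
    (e : Sym2 V) : ℝ :=
  sInf {x : ℝ | ∃ u v : V, e = s(u, v) ∧ ∃ p : G.Walk u v, x = (p.edges.map c).sum}

/-- The edges in the list `P` connect the endpoints of `e`. -/
def ConnectsEnds {V : Type} (P : List (Sym2 V)) (e : Sym2 V) : Prop :=
  ∀ u v, e = s(u, v) → (SimpleGraph.fromEdgeSet {x | x ∈ P}).Reachable u v

lemma ConnectsEnds.mono {V : Type} {P Q : List (Sym2 V)} {e : Sym2 V}
    (h : ConnectsEnds P e) (hPQ : P ⊆ Q) : ConnectsEnds Q e :=
  fun u v he => (h u v he).mono (SimpleGraph.fromEdgeSet_mono fun _ hx => hPQ hx)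

lemma connectsEnds_of_mem {V : Type} {P : List (Sym2 V)} {e : Sym2 V} (he : e ∈ P) :
    ConnectsEnds P e := by
  rintro u v rfl
  by_cases huv : u = v
  · exact huv ▸ SimpleGraph.Reachable.refl _
  · exact SimpleGraph.Adj.reachable ((SimpleGraph.fromEdgeSet_adj _).2 ⟨he, huv⟩)

lemma SimpleGraph.Walk.connectsEnds_edges {V : Type} {G : SimpleGraph V} {u v : V}
    (p : G.Walk u v) : ConnectsEnds p.edges s(u, v) := by
  have key : (SimpleGraph.fromEdgeSet {x | x ∈ p.edges}).Reachable u v := by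
    refine ⟨p.transfer _ fun e he => ?_⟩
    rw [SimpleGraph.edgeSet_fromEdgeSet]
    exact ⟨he, G.not_isDiag_of_mem_edgeSet (p.edges_subset_edgeSet he)⟩
  intro a b h
  rcases Sym2.eq_iff.1 h with ⟨rfl, rfl⟩ | ⟨rfl, rfl⟩
  · exact key
  · exact key.symm

lemma SimpleGraph.Reachable.of_connectsEnds {V : Type} {P Q : List (Sym2 V)}
    (h : ∀ e ∈ P, ConnectsEnds Q e) {u v : V}
    (huv : (SimpleGraph.fromEdgeSet {x | x ∈ P}).Reachable u v) :
    (SimpleGraph.fromEdgeSet {x | x ∈ Q}).Reachable u v := by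
  obtain ⟨p⟩ := huv
  induction p with
  | nil => exact SimpleGraph.Reachable.refl _
  | cons hadj _ ih =>
    exact (h _ ((SimpleGraph.fromEdgeSet_adj _).1 hadj).1 _ _ rfl).trans ih

lemma List.Sublist.sum_map_le {α : Type} {c : α → ℝ} {l₁ l₂ : List α} (h : l₁.Sublist l₂)
    (hc : ∀ x ∈ l₂, 0 ≤ c x) : (l₁.map c).sum ≤ (l₂.map c).sum :=
  (h.map c).sum_le_sum (by simpa using hc)

lemma connTime_le_of_isPrefix {V : Type} {c : Sym2 V → ℝ} {L P : List (Sym2 V)} {u v : V}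
    (hc : ∀ e ∈ L, 0 ≤ c e) (hP : P <+: L)
    (h : (SimpleGraph.fromEdgeSet {e | e ∈ P}).Reachable u v) :
    connTime c L u v ≤ (P.map c).sum := by
  rw [List.prefix_iff_eq_take.1 hP] at h ⊢
  exact ((List.take_prefix_take_left (Nat.sInf_le h)).sublist).sum_map_le
    fun e he => hc e (List.mem_of_mem_take he)

lemma exists_isPrefix_connTime_eq {V : Type} (c : Sym2 V → ℝ) {L : List (Sym2 V)} {u v : V}
    (h : (SimpleGraph.fromEdgeSet {e | e ∈ L}).Reachable u v) :
    ∃ P, P <+: L ∧ (SimpleGraph.fromEdgeSet {e | e ∈ P}).Reachable u v ∧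
      connTime c L u v = (P.map c).sum := by
  have hne : {k : ℕ | (SimpleGraph.fromEdgeSet {e | e ∈ L.take k}).Reachable u v}.Nonempty :=
    ⟨L.length, by simpa using h⟩
  exact ⟨_, List.take_prefix _ L, Nat.sInf_mem hne, rfl⟩

lemma totalCost_nonneg {V : Type} {r : ℕ} {c : Sym2 V → ℝ} {w : Fin r → ℝ}
    (pair : Fin r → V × V) {L : List (Sym2 V)} (hc : ∀ e ∈ L, 0 ≤ c e) (hw : ∀ i, 0 ≤ w i) :
    0 ≤ totalCost c w pair L := by
  refine Finset.sum_nonneg fun i _ => mul_nonneg (hw i) (List.sum_nonneg ?_)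
  simp only [List.mem_map, forall_exists_index, and_imp]
  rintro _ e he rfl
  exact hc e (List.mem_of_mem_take he)

/-- If every edge of `L` can be replaced by a list of edges from `s` that connects its endpoints
at no greater cost, then some duplicate-free list in `s` dominates `L` prefix by prefix. -/
lemma exists_nodup_dominating {V : Type} {c c' : Sym2 V → ℝ} {s : Set (Sym2 V)}
    (hc' : ∀ e ∈ s, 0 ≤ c' e) (L : List (Sym2 V))
    (hL : ∀ e ∈ L, ∃ l : List (Sym2 V), (∀ x ∈ l, x ∈ s) ∧ (l.map c').sum ≤ c e ∧
      ConnectsEnds l e) :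
    ∃ L' : List (Sym2 V), L'.Nodup ∧ (∀ x ∈ L', x ∈ s) ∧
      ∀ P, P <+: L → ∃ P', P' <+: L' ∧ (P'.map c').sum ≤ (P.map c).sum ∧
        ∀ e ∈ P, ConnectsEnds P' e := by
  classical
  suffices h : ∃ L' : List (Sym2 V), L'.Nodup ∧ (∀ x ∈ L', x ∈ s) ∧
      ((L'.map c').sum ≤ (L.map c).sum ∧ ∀ e ∈ L, ConnectsEnds L' e) ∧
      ∀ P, P <+: L → ∃ P', P' <+: L' ∧ (P'.map c').sum ≤ (P.map c).sum ∧
        ∀ e ∈ P, ConnectsEnds P' e by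
    obtain ⟨L', h₁, h₂, -, h₃⟩ := h
    exact ⟨L', h₁, h₂, h₃⟩
  induction L using List.reverseRecOn with
  | nil => exact ⟨[], by simp⟩
  | append_singleton L e ih =>
    obtain ⟨L', hnd, hs, ⟨hsum, hends⟩, hpre⟩ := ih fun x hx => hL x (by simp [hx])
    obtain ⟨l, hls, hlsum, hle⟩ := hL e (by simp)
    set m := l.dedup.filter (· ∉ L') with hm
    have hml : m.Sublist l := List.filter_sublist.trans (List.dedup_sublist l)
    have hmsum : (m.map c').sum ≤ (l.map c').sum :=
      hml.sum_map_le fun x hx => hc' x (hls x hx)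
    have hsum' : ((L' ++ m).map c').sum ≤ ((L ++ [e]).map c).sum := by
      simp only [List.map_append, List.sum_append, List.map_cons, List.map_nil, List.sum_cons,
        List.sum_nil]
      linarith
    have hends' : ∀ x ∈ L ++ [e], ConnectsEnds (L' ++ m) x := by
      intro x hx
      rcases List.mem_append.1 hx with hx | hx
      · exact (hends x hx).mono (List.subset_append_left _ _)
      · obtain rfl := List.mem_singleton.1 hx
        refine hle.mono fun y hy => ?_
        by_cases hyL : y ∈ L' <;> simp [hm, hy, hyL]
    refine ⟨L' ++ m, ?_, ?_, ⟨hsum', hends'⟩, ?_⟩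
    · refine hnd.append ((List.nodup_dedup l).filter _) fun x hx hxm => ?_
      simp [hm, hx] at hxm
    · intro x hx
      rcases List.mem_append.1 hx with hx | hx
      · exact hs x hx
      · exact hls x (hml.subset hx)
    · intro P hP
      rcases List.prefix_concat_iff.1 hP with rfl | hP
      · exact ⟨_, List.prefix_rfl, hsum', hends'⟩
      · obtain ⟨P', hP', h⟩ := hpre P hP
        exact ⟨P', hP'.trans (List.prefix_append _ _), h⟩

lemma List.Nodup.exists_isOrdering_isPrefix {α : Type} {L : List α} {s : Set α}
    (hL : L.Nodup) (hs : ∀ x ∈ L, x ∈ s) (hfin : s.Finite) :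
    ∃ L', IsOrdering L' s ∧ L <+: L' := by
  classical
  refine ⟨L ++ (hfin.toFinset.toList.filter (· ∉ L)), ⟨?_, fun e => ?_⟩, List.prefix_append _ _⟩
  · refine hL.append (hfin.toFinset.nodup_toList.filter _) fun x hx hx' => ?_
    simp [hx] at hx'
  · by_cases he : e ∈ L
    · simp [he, hs e he]
    · simp [he]

lemma exists_isOrdering_totalCost_le {V : Type} {r : ℕ} {c c' : Sym2 V → ℝ}
    {w : Fin r → ℝ} (pair : Fin r → V × V) {s : Set (Sym2 V)} (hfin : s.Finite)
    (hc' : ∀ e ∈ s, 0 ≤ c' e) (hw : ∀ i, 0 ≤ w i) {L : List (Sym2 V)}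
    (hconn : (SimpleGraph.fromEdgeSet {e | e ∈ L}).Preconnected)
    (hL : ∀ e ∈ L, ∃ l : List (Sym2 V), (∀ x ∈ l, x ∈ s) ∧ (l.map c').sum ≤ c e ∧
      ConnectsEnds l e) :
    ∃ L', IsOrdering L' s ∧ totalCost c' w pair L' ≤ totalCost c w pair L := by
  obtain ⟨M, hnd, hs, hdom⟩ := exists_nodup_dominating hc' L hL
  obtain ⟨L', hL', hML'⟩ := hnd.exists_isOrdering_isPrefix hs hfin
  refine ⟨L', hL', Finset.sum_le_sum fun i _ => mul_le_mul_of_nonneg_left ?_ (hw i)⟩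
  obtain ⟨P, hP, hreach, heq⟩ := exists_isPrefix_connTime_eq c (hconn (pair i).1 (pair i).2)
  obtain ⟨P', hP', hsum, hends⟩ := hdom P hP
  rw [heq]
  exact (connTime_le_of_isPrefix (fun e he => hc' e ((hL'.2 e).1 he)) (hP'.trans hML')
    (hreach.of_connectsEnds hends)).trans hsum

lemma IsOrdering.fromEdgeSet_eq {V : Type} {G : SimpleGraph V} {L : List (Sym2 V)}
    (hL : IsOrdering L G.edgeSet) : SimpleGraph.fromEdgeSet {e | e ∈ L} = G := by
  rw [show {e | e ∈ L} = G.edgeSet from Set.ext hL.2, SimpleGraph.fromEdgeSet_edgeSet]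

section MetricClosure

variable {V : Type} {G : SimpleGraph V} {c : Sym2 V → ℝ}

lemma SimpleGraph.Walk.sum_map_edges_nonneg (hc : ∀ e ∈ G.edgeSet, 0 ≤ c e) {u v : V}
    (p : G.Walk u v) : 0 ≤ (p.edges.map c).sum := by
  refine List.sum_nonneg ?_
  simp only [List.mem_map, forall_exists_index, and_imp]
  rintro _ e he rfl
  exact hc e (p.edges_subset_edgeSet he)

lemma mcLength_nonneg (hc : ∀ e ∈ G.edgeSet, 0 ≤ c e) (e : Sym2 V) : 0 ≤ mcLength G c e := by
  refine Real.sInf_nonneg ?_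
  rintro _ ⟨u, v, -, p, rfl⟩
  exact p.sum_map_edges_nonneg hc

lemma mcLength_le (hc : ∀ e ∈ G.edgeSet, 0 ≤ c e) {e : Sym2 V} (he : e ∈ G.edgeSet) :
    mcLength G c e ≤ c e := by
  refine csInf_le ⟨0, ?_⟩ ?_
  · rintro _ ⟨u, v, -, p, rfl⟩
    exact p.sum_map_edges_nonneg hc
  · induction e with
    | h u v => exact ⟨u, v, rfl, (G.mem_edgeSet.1 he).toWalk, by simp [SimpleGraph.Adj.toWalk]⟩

/-- The infimum defining the shortest-path distance is attained up to `≤`. -/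
lemma exists_walk_le_mcLength [Finite V] (hconn : G.Connected)
    (hc : ∀ e ∈ G.edgeSet, 0 ≤ c e) (e : Sym2 V) :
    ∃ (u v : V) (p : G.Walk u v), e = s(u, v) ∧ (p.edges.map c).sum ≤ mcLength G c e := by
  classical
  have := Fintype.ofFinite V
  let T : Set ℝ := {x | ∃ u v : V, e = s(u, v) ∧ ∃ p : G.Walk u v, p.IsPath ∧
    x = (p.edges.map c).sum}
  have hfin : T.Finite := by
    refine (Set.finite_range fun F : Finset (Sym2 V) => ∑ x ∈ F, c x).subset ?_
    rintro _ ⟨u, v, -, p, hp, rfl⟩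
    exact ⟨p.edges.toFinset, List.sum_toFinset c hp.isTrail.edges_nodup⟩
  have hbypass : ∀ u v : V, e = s(u, v) → ∀ p : G.Walk u v,
      ∃ x ∈ T, x ≤ (p.edges.map c).sum := fun u v he p =>
    ⟨_, ⟨u, v, he, p.bypass, p.bypass_isPath, rfl⟩,
      p.edges_bypass_sublist_edges.sum_map_le fun x hx => hc x (p.edges_subset_edgeSet hx)⟩
  obtain ⟨a, b, hab⟩ : ∃ a b, e = s(a, b) := ⟨_, _, (Quot.out_eq e).symm⟩
  obtain ⟨q⟩ := hconn.preconnected a b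
  obtain ⟨y, hy, -⟩ := hbypass a b hab q
  obtain ⟨_, ⟨u, v, he, p, -, rfl⟩, hmin⟩ := Set.exists_min_image T id hfin ⟨y, hy⟩
  refine ⟨u, v, p, he, le_csInf ⟨_, a, b, hab, q, rfl⟩ ?_⟩
  rintro _ ⟨u', v', he', p', rfl⟩
  obtain ⟨x, hx, hle⟩ := hbypass u' v' he' p'
  exact (hmin x hx).trans hle

end MetricClosure

/-- for a finite connected graph `G` with positive edge lengths and relevant
pairs of distinct vertices with positive weights, the minimum total weighted connection
time over linear orderings of the edges of `G` equals the minimum over linear orderings of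
the edges of the metric closure `Ĝ = ⊤` (with the shortest-path-distance edge lengths). -/
theorem stmt9 (V : Type) [Fintype V] [DecidableEq V] (G : SimpleGraph V)
    (hconn : G.Connected) (c : Sym2 V → ℝ) (hc : ∀ e ∈ G.edgeSet, 0 < c e)
    (r : ℕ) (pair : Fin r → V × V) (hpair : ∀ i, (pair i).1 ≠ (pair i).2)
    (w : Fin r → ℝ) (hw : ∀ i, 0 < w i) :
    sInf {x : ℝ | ∃ L : List (Sym2 V), IsOrdering L G.edgeSet ∧ x = totalCost c w pair L}
    = sInf {x : ℝ | ∃ L : List (Sym2 V), IsOrdering L (⊤ : SimpleGraph V).edgeSet ∧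
        x = totalCost (mcLength G c) w pair L} := by
  have hc₀ : ∀ e ∈ G.edgeSet, 0 ≤ c e := fun e he => (hc e he).le
  have hw₀ : ∀ i, 0 ≤ w i := fun i => (hw i).le
  have hne : ∀ s : Set (Sym2 V), ∃ L, IsOrdering L s := fun s =>
    let ⟨L, hL, _⟩ := List.nodup_nil.exists_isOrdering_isPrefix (by simp) s.toFinite
    ⟨L, hL⟩
  apply le_antisymm
  · refine le_csInf (let ⟨L, hL⟩ := hne _; ⟨_, L, hL, rfl⟩) ?_
    rintro _ ⟨L, hL, rfl⟩
    have : Nonempty V := hconn.nonempty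
    obtain ⟨L', hL', hle⟩ := exists_isOrdering_totalCost_le (c := mcLength G c) (w := w) pair
      (Set.toFinite G.edgeSet) hc₀ hw₀
      (by rw [hL.fromEdgeSet_eq]; exact SimpleGraph.connected_top.preconnected) fun e _ => by
        obtain ⟨u, v, p, rfl, hp⟩ := exists_walk_le_mcLength hconn hc₀ e
        exact ⟨p.edges, fun x hx => p.edges_subset_edgeSet hx, hp, p.connectsEnds_edges⟩
    refine csInf_le_of_le ⟨0, ?_⟩ ⟨L', hL', rfl⟩ hle
    rintro _ ⟨M, hM, rfl⟩
    exact totalCost_nonneg pair (fun e he => hc₀ e ((hM.2 e).1 he)) hw₀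
  · refine le_csInf (let ⟨L, hL⟩ := hne _; ⟨_, L, hL, rfl⟩) ?_
    rintro _ ⟨L, hL, rfl⟩
    obtain ⟨L', hL', hle⟩ := exists_isOrdering_totalCost_le (c := c) (c' := mcLength G c) (w := w)
      pair (Set.toFinite (⊤ : SimpleGraph V).edgeSet) (fun e _ => mcLength_nonneg hc₀ e) hw₀
      (by rw [hL.fromEdgeSet_eq]; exact hconn.preconnected) fun e he => by
        have heG := (hL.2 e).1 he
        refine ⟨[e], ?_, by simpa using mcLength_le hc₀ heG, connectsEnds_of_mem (by simp)⟩
        rintro x hx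
        obtain rfl := List.mem_singleton.1 hx
        exact SimpleGraph.edgeSet_mono le_top heG
    refine csInf_le_of_le ⟨0, ?_⟩ ⟨L', hL', rfl⟩ hle
    rintro _ ⟨M, -, rfl⟩
    exact totalCost_nonneg pair (fun e _ => mcLength_nonneg hc₀ e) hw₀
end

section
/- Let G = (V, E) be a finite connected simple graph with edge lengths c(e) > 0, relevant pairs {v_1,u_1}, …, {v_r,u_r} of distinct vertices with weights w_i > 0, and metric closure Ĝ (the complete graph on V with edge lengths d_G(u,v)). Then for every acyclic subgraph F̂ of Ĝ in which every relevant pair is connected, there exists an acyclic subgraph F of G in which every relevant pair is connected, such that the minimum over linear orderings of the edges of F of the total weighted connection time (computed with the edge lengths of G) is at most the minimum over linear orderings of the edges of F̂ of the total weighted connection time (computed with the edge lengths of Ĝ). Here, for a linear ordering L of an edge set, the connection time of pair i is the sum of the lengths of the edges in the shortest prefix of L whose edges connect v_i and u_i, and the total weighted connection time is Σ_{i=1}^r w_i times these connection times. -/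
namespace SimpleGraph

variable {V : Type}

lemma Reachable.of_forall_adj {G H : SimpleGraph V}
    (h : ∀ a b, G.Adj a b → H.Reachable a b) {u v : V} (huv : G.Reachable u v) :
    H.Reachable u v := by
  obtain ⟨p⟩ := huv
  induction p with
  | nil => exact Reachable.refl _
  | cons hadj _ ih => exact (h _ _ hadj).trans ih

lemma Reachable.of_forall_mem {S : Set (Sym2 V)} {H : SimpleGraph V}
    (h : ∀ a b, s(a, b) ∈ S → H.Reachable a b) {u v : V}
    (huv : (fromEdgeSet S).Reachable u v) : H.Reachable u v :=
  huv.of_forall_adj fun a b hab => h a b ((fromEdgeSet_adj S).1 hab).1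

lemma reachable_fromEdgeSet_of_mem {S : Set (Sym2 V)} {a b : V} (h : s(a, b) ∈ S) :
    (fromEdgeSet S).Reachable a b := by
  by_cases hab : a = b
  · exact hab ▸ Reachable.refl a
  · exact Adj.reachable ((fromEdgeSet_adj S).2 ⟨h, hab⟩)

lemma Walk.reachable_fromEdgeSet_edges {G : SimpleGraph V} {u v : V} (p : G.Walk u v) :
    (fromEdgeSet {e | e ∈ p.edges}).Reachable u v := by
  induction p with
  | nil => exact Reachable.refl _
  | cons hadj q ih =>
    refine (reachable_fromEdgeSet_of_mem (by simp)).trans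
      (ih.mono (fromEdgeSet_mono fun e he => ?_))
    simpa using Or.inr he

/-- Kruskal-style pruning: from a list of edges one can extract a sublist forming a forest such
that every prefix of the list is spanned by a prefix of the sublist. -/
lemma exists_forest_sublist (M : List (Sym2 V)) :
    ∃ L : List (Sym2 V), L.Sublist M ∧ L.Nodup ∧ (fromEdgeSet {e | e ∈ L}).IsAcyclic ∧
      ∀ m, m <+: M → ∃ l, l <+: L ∧ l.Sublist m ∧
        ∀ a b, s(a, b) ∈ m → (fromEdgeSet {e | e ∈ l}).Reachable a b := by
  induction M using List.reverseRecOn with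
  | nil =>
    refine ⟨[], List.Sublist.refl _, List.nodup_nil, ?_, fun m hm => ⟨[], ?_⟩⟩
    · simp
    · simp [List.prefix_nil.1 hm]
  | append_singleton M e ih =>
    obtain ⟨L, hLM, hnodup, hacyc, hpre⟩ := ih
    obtain ⟨l, hl, -, hspan⟩ := hpre M (List.prefix_refl M)
    have hspanL : ∀ a b, s(a, b) ∈ M → (fromEdgeSet {e | e ∈ L}).Reachable a b :=
      fun a b hab => (hspan a b hab).mono (fromEdgeSet_mono fun e he => hl.subset he)
    induction e using Sym2.ind with
    | _ x y =>
    by_cases hxy : (fromEdgeSet {e | e ∈ L}).Reachable x y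
    · refine ⟨L, hLM.trans (List.sublist_append_left _ _), hnodup, hacyc, fun m hm => ?_⟩
      rcases List.prefix_concat_iff.1 hm with rfl | hm
      · refine ⟨L, List.prefix_refl L, hLM.trans (List.sublist_append_left _ _),
          fun a b hab => ?_⟩
        rcases List.mem_append.1 hab with hab | hab
        · exact hspanL a b hab
        · rcases Sym2.eq_iff.1 (List.mem_singleton.1 hab) with ⟨rfl, rfl⟩ | ⟨rfl, rfl⟩
          · exact hxy
          · exact hxy.symm
      · exact hpre m hm
    · refine ⟨L ++ [s(x, y)], hLM.append_right _, ?_, ?_, fun m hm => ?_⟩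
      · rw [← List.concat_eq_append]
        exact hnodup.concat fun h => hxy (reachable_fromEdgeSet_of_mem h)
      · have h : {e | e ∈ L ++ [s(x, y)]} = {e | e ∈ L} ∪ {s(x, y)} := by
          ext; simp [or_comm]
        rw [h, fromEdgeSet_union]
        exact (isAcyclic_add_edge_iff_of_not_reachable x y hxy).2 hacyc
      · rcases List.prefix_concat_iff.1 hm with rfl | hm
        · refine ⟨_, List.prefix_refl _, hLM.append_right _, fun a b hab => ?_⟩
          rcases List.mem_append.1 hab with hab | hab
          · exact (hspanL a b hab).mono
              (fromEdgeSet_mono fun e he => List.mem_append_left _ he)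
          · exact reachable_fromEdgeSet_of_mem (List.mem_append_right _ hab)
        · obtain ⟨l, hl, hlm⟩ := hpre m hm
          exact ⟨l, hl.trans (List.prefix_append _ _), hlm⟩

lemma Walk.sum_edges_bypass_le [DecidableEq V] {G : SimpleGraph V} {c : Sym2 V → ℝ}
    (hc : ∀ e ∈ G.edgeSet, 0 ≤ c e) {u v : V} (p : G.Walk u v) :
    (p.bypass.edges.map c).sum ≤ (p.edges.map c).sum := by
  refine (p.edges_bypass_sublist_edges.map c).sum_le_sum fun x hx => ?_
  obtain ⟨e, he, rfl⟩ := List.mem_map.1 hx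
  exact hc e (p.edges_subset_edgeSet he)

/-- The infimum defining the metric closure is attained. -/
lemma exists_walk_sum_edges_eq_mcLength [Finite V] {G : SimpleGraph V} (hconn : G.Connected)
    {c : Sym2 V → ℝ} (hc : ∀ e ∈ G.edgeSet, 0 ≤ c e) (e : Sym2 V) :
    ∃ u v : V, e = s(u, v) ∧ ∃ p : G.Walk u v, (p.edges.map c).sum = mcLength G c e := by
  classical
  have := Fintype.ofFinite V
  let T : Set ℝ := {x | ∃ u v : V, e = s(u, v) ∧
    ∃ p : G.Walk u v, p.IsPath ∧ x = (p.edges.map c).sum}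
  have hfin : T.Finite := by
    refine (Set.finite_range fun l : {l : List (Sym2 V) // l.Nodup} =>
      (l.1.map c).sum).subset ?_
    rintro _ ⟨u, v, -, p, hp, rfl⟩
    exact ⟨⟨p.edges, hp.edges_nodup⟩, rfl⟩
  have hne : T.Nonempty := by
    induction e using Sym2.ind with
    | _ x y =>
    obtain ⟨p⟩ := hconn.preconnected x y
    exact ⟨_, x, y, rfl, p.bypass, p.bypass_isPath, rfl⟩
  obtain ⟨u, v, he, p, -, hp⟩ := hne.csInf_mem hfin
  refine ⟨u, v, he, p, ?_⟩
  have hleast : IsLeast {x : ℝ | ∃ u v : V, e = s(u, v) ∧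
      ∃ p : G.Walk u v, x = (p.edges.map c).sum} (p.edges.map c).sum := by
    refine ⟨⟨u, v, he, p, rfl⟩, ?_⟩
    rintro _ ⟨u', v', he', q, rfl⟩
    refine le_trans ?_ (q.sum_edges_bypass_le hc)
    rw [← hp]
    exact csInf_le hfin.bddBelow ⟨u', v', he', q.bypass, q.bypass_isPath, rfl⟩
  exact hleast.csInf_eq.symm

end SimpleGraph

lemma connTime_le_of_prefix {V : Type} {c : Sym2 V → ℝ} {L l : List (Sym2 V)} {u v : V}
    (hc : ∀ e ∈ L, 0 ≤ c e) (hl : l <+: L)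
    (huv : (SimpleGraph.fromEdgeSet {e | e ∈ l}).Reachable u v) :
    connTime c L u v ≤ (l.map c).sum := by
  have hlt : L.take l.length = l := (List.prefix_iff_eq_take.1 hl).symm
  have hle : sInf {k : ℕ | (SimpleGraph.fromEdgeSet {e | e ∈ L.take k}).Reachable u v}
      ≤ l.length := Nat.sInf_le (by simpa only [Set.mem_ofPred_eq, hlt] using huv)
  have hsub := List.take_sublist_take_left (l := L) hle
  rw [hlt] at hsub
  refine (hsub.map c).sum_le_sum fun x hx => ?_
  obtain ⟨e, he, rfl⟩ := List.mem_map.1 hx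
  exact hc e (hl.subset he)

lemma exists_prefix_sum_eq_connTime {V : Type} (c : Sym2 V → ℝ) {L : List (Sym2 V)} {u v : V}
    (huv : (SimpleGraph.fromEdgeSet {e | e ∈ L}).Reachable u v) :
    ∃ l, l <+: L ∧ (SimpleGraph.fromEdgeSet {e | e ∈ l}).Reachable u v ∧
      (l.map c).sum = connTime c L u v := by
  refine ⟨_, List.take_prefix _ L, ?_, rfl⟩
  exact Nat.sInf_mem
    (s := {k | (SimpleGraph.fromEdgeSet {e | e ∈ L.take k}).Reachable u v})
    ⟨L.length, by simpa using huv⟩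

/-- Every schedule of metric-closure edges can be turned into a schedule of a forest of `G`
connecting each pair no later. -/
lemma exists_forest_connTime_le {V : Type} [Finite V] {G : SimpleGraph V}
    (hconn : G.Connected) {c : Sym2 V → ℝ} (hc : ∀ e ∈ G.edgeSet, 0 ≤ c e)
    (K : List (Sym2 V)) :
    ∃ L : List (Sym2 V), L.Nodup ∧ (∀ e ∈ L, e ∈ G.edgeSet) ∧
      (SimpleGraph.fromEdgeSet {e | e ∈ L}).IsAcyclic ∧
      ∀ u v, (SimpleGraph.fromEdgeSet {e | e ∈ K}).Reachable u v →
        (SimpleGraph.fromEdgeSet {e | e ∈ L}).Reachable u v ∧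
          connTime c L u v ≤ connTime (mcLength G c) K u v := by
  choose x y hxy p hp using SimpleGraph.exists_walk_sum_edges_eq_mcLength hconn hc
  obtain ⟨L, hLM, hnodup, hacyc, hpre⟩ :=
    SimpleGraph.exists_forest_sublist (K.flatMap fun e => (p e).edges)
  have hflat : ∀ (k : List (Sym2 V)), ∀ e ∈ k.flatMap fun e => (p e).edges, e ∈ G.edgeSet := by
    intro k e he
    obtain ⟨f, -, hf⟩ := List.mem_flatMap.1 he
    exact (p f).edges_subset_edgeSet hf
  have hLG : ∀ e ∈ L, e ∈ G.edgeSet := fun e he => hflat K e (hLM.subset he)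
  refine ⟨L, hnodup, hLG, hacyc, fun u v huv => ?_⟩
  obtain ⟨k, hk, hkuv, hsum⟩ := exists_prefix_sum_eq_connTime (mcLength G c) huv
  obtain ⟨l, hl, hlm, hspan⟩ := hpre (k.flatMap fun e => (p e).edges) (by
    obtain ⟨t, rfl⟩ := hk
    rw [List.flatMap_append]
    exact List.prefix_append _ _)
  have hluv : (SimpleGraph.fromEdgeSet {e | e ∈ l}).Reachable u v := by
    refine hkuv.of_forall_mem fun a b hab => ?_
    have hr : (SimpleGraph.fromEdgeSet {e | e ∈ l}).Reachable (x s(a, b)) (y s(a, b)) :=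
      (p s(a, b)).reachable_fromEdgeSet_edges.of_forall_mem fun a' b' h =>
        hspan a' b' (List.mem_flatMap.2 ⟨_, hab, h⟩)
    rcases Sym2.eq_iff.1 (hxy s(a, b)) with ⟨ha, hb⟩ | ⟨ha, hb⟩
    · rwa [← ha, ← hb] at hr
    · rw [← ha, ← hb] at hr
      exact hr.symm
  refine ⟨hluv.mono (SimpleGraph.fromEdgeSet_mono fun e he => hl.subset he), ?_⟩
  calc connTime c L u v ≤ (l.map c).sum :=
        connTime_le_of_prefix (fun e he => hc e (hLG e he)) hl hluv
    _ ≤ ((k.flatMap fun e => (p e).edges).map c).sum := by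
        refine (hlm.map c).sum_le_sum fun z hz => ?_
        obtain ⟨e, he, rfl⟩ := List.mem_map.1 hz
        exact hc e (hflat k e he)
    _ = (k.map (mcLength G c)).sum := by
        clear hk hkuv hsum hlm hspan
        induction k with
        | nil => rfl
        | cons e k ih => simp [ih, hp]
    _ = connTime (mcLength G c) K u v := hsum

lemma finite_setOf_isOrdering {α : Type} [Finite α] (f : List α → ℝ) (s : Set α) :
    {x : ℝ | ∃ L : List α, IsOrdering L s ∧ x = f L}.Finite := by
  classical
  have := Fintype.ofFinite α
  refine (Set.finite_range fun l : {l : List α // l.Nodup} => f l.1).subset ?_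
  rintro _ ⟨L, hL, rfl⟩
  exact ⟨⟨L, hL.1⟩, rfl⟩

/-- Lemma 6 / lemR2: for every acyclic edge set `Fh` of the metric closure
`Ĝ = ⊤` connecting every relevant pair, there is an acyclic edge set `F` of `G` connecting
every relevant pair whose optimal total weighted connection time (with the lengths of `G`)
is at most that of `Fh` (with the metric-closure lengths). -/
theorem stmt11 (V : Type) [Fintype V] [DecidableEq V] (G : SimpleGraph V)
    (hconn : G.Connected) (c : Sym2 V → ℝ) (hc : ∀ e ∈ G.edgeSet, 0 < c e)
    (r : ℕ) (pair : Fin r → V × V) (hpair : ∀ i, (pair i).1 ≠ (pair i).2)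
    (w : Fin r → ℝ) (hw : ∀ i, 0 < w i)
    (Fh : Finset (Sym2 V)) (hFhsub : ↑Fh ⊆ (⊤ : SimpleGraph V).edgeSet)
    (hFhacyclic : (SimpleGraph.fromEdgeSet (↑Fh : Set (Sym2 V))).IsAcyclic)
    (hFhconn : ∀ i, (SimpleGraph.fromEdgeSet (↑Fh : Set (Sym2 V))).Reachable
        (pair i).1 (pair i).2) :
    ∃ F : Finset (Sym2 V),
      ↑F ⊆ G.edgeSet ∧
      (SimpleGraph.fromEdgeSet (↑F : Set (Sym2 V))).IsAcyclic ∧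
      (∀ i, (SimpleGraph.fromEdgeSet (↑F : Set (Sym2 V))).Reachable
          (pair i).1 (pair i).2) ∧
      sInf {x : ℝ | ∃ L : List (Sym2 V), IsOrdering L ↑F ∧ x = totalCost c w pair L}
        ≤ sInf {x : ℝ | ∃ L : List (Sym2 V), IsOrdering L ↑Fh ∧
            x = totalCost (mcLength G c) w pair L} := by
  obtain ⟨K, hK, hKmin⟩ := Set.Nonempty.csInf_mem
    (⟨_, Fh.toList, ⟨Fh.nodup_toList, by simp⟩, rfl⟩ :
      {x : ℝ | ∃ L : List (Sym2 V), IsOrdering L ↑Fh ∧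
        x = totalCost (mcLength G c) w pair L}.Nonempty)
    (finite_setOf_isOrdering _ _)
  have hKset : {e | e ∈ K} = (↑Fh : Set (Sym2 V)) := Set.ext hK.2
  obtain ⟨L, hnodup, hLG, hacyc, hL⟩ :=
    exists_forest_connTime_le hconn (fun e he => (hc e he).le) K
  rw [hKset] at hL
  have hLset : (↑L.toFinset : Set (Sym2 V)) = {e | e ∈ L} := List.coe_toFinset L
  refine ⟨L.toFinset, ?_, ?_, fun i => ?_, ?_⟩
  · rw [hLset]
    exact hLG
  · rwa [hLset]
  · rw [hLset]
    exact (hL _ _ (hFhconn i)).1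
  · rw [hKmin]
    refine (csInf_le (finite_setOf_isOrdering _ _).bddBelow
      ⟨L, ⟨hnodup, by simp⟩, rfl⟩).trans ?_
    exact Finset.sum_le_sum fun i _ =>
      mul_le_mul_of_nonneg_left (hL _ _ (hFhconn i)).2 (hw i).le
end

section
/- Let G = (V, E) be a finite connected simple graph with edge lengths c(e) > 0, relevant pairs {v_1,u_1}, …, {v_r,u_r} of distinct vertices with weights w_i > 0, and metric closure Ĝ (the complete graph on V with edge lengths d_G(u,v)). Call a vertex terminal if it belongs to some relevant pair. Then there exists an acyclic subgraph F̂* of Ĝ in which every relevant pair is connected, having at most 2r − 2 non-terminal vertices, such that the minimum over linear orderings of the edges of F̂* of the total weighted connection time equals the minimum over linear orderings of the full edge set of Ĝ of the total weighted connection time, and this common value equals the minimum over linear orderings of E of the total weighted connection time in G. Here, for a linear ordering L of an edge set, the connection time of pair i is the sum of the lengths of the edges in the shortest prefix of L whose edges connect v_i and u_i, and the total weighted connection time is Σ_{i=1}^r w_i times these connection times. -/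
namespace NetworkSchedule

open SimpleGraph

variable {V : Type}

/-- The graph whose edges are the (non-loop) members of a list. -/
abbrev listGraph (A : List (Sym2 V)) : SimpleGraph V :=
  fromEdgeSet {e | e ∈ A}

/-- `L'` with lengths `c'` dominates `L` with lengths `c` on `T`: every initial segment of `L` is
matched by one of `L'` that is no longer and connects all the pairs in `T` the former connects. -/
def Dominates (T : Set V) (c' c : Sym2 V → ℝ) (L' L : List (Sym2 V)) : Prop :=
  ∀ A, A <+: L → ∃ B, B <+: L' ∧ (B.map c').sum ≤ (A.map c).sum ∧
    ∀ u ∈ T, ∀ v ∈ T, (listGraph A).Reachable u v → (listGraph B).Reachable u v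

lemma reachable_map {A B : List (Sym2 V)} (f : V → V)
    (h : ∀ x y, x ≠ y → s(x, y) ∈ A → (listGraph B).Reachable (f x) (f y)) {u v : V}
    (huv : (listGraph A).Reachable u v) : (listGraph B).Reachable (f u) (f v) := by
  obtain ⟨p⟩ := huv
  induction p with
  | nil => exact Reachable.refl _
  | cons hadj p ih =>
    rw [fromEdgeSet_adj] at hadj
    exact (h _ _ hadj.2 hadj.1).trans ih

lemma reachable_of_mem {A : List (Sym2 V)} {x y : V} (h : s(x, y) ∈ A) :
    (listGraph A).Reachable x y := by
  by_cases hxy : x = y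
  · rw [hxy]
  · exact Adj.reachable ((fromEdgeSet_adj _).2 ⟨h, hxy⟩)

lemma reachable_mono {A B : List (Sym2 V)} (h : A ⊆ B) {u v : V}
    (huv : (listGraph A).Reachable u v) : (listGraph B).Reachable u v :=
  huv.mono (fromEdgeSet_mono fun _ he => h he)

lemma prefix_append_cons {α : Type} {A X Y : List α} {e : α} (h : A <+: X ++ e :: Y) :
    A <+: X ∨ ∃ Z, Z <+: Y ∧ A = X ++ e :: Z := by
  induction X generalizing A with
  | nil =>
    rw [List.nil_append, List.prefix_cons_iff] at h
    rcases h with rfl | ⟨t, rfl, ht⟩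
    · exact Or.inl ⟨_, List.nil_append _⟩
    · exact Or.inr ⟨t, ht, rfl⟩
  | cons x X ih =>
    rw [List.cons_append, List.prefix_cons_iff] at h
    rcases h with rfl | ⟨t, rfl, ht⟩
    · exact Or.inl ⟨_, List.nil_append _⟩
    · rcases ih ht with h | ⟨Z, hZ, rfl⟩
      · exact Or.inl (List.cons_prefix_cons.2 ⟨rfl, h⟩)
      · exact Or.inr ⟨Z, hZ, rfl⟩

lemma sum_map_le_of_sublist {c : Sym2 V → ℝ} {A B : List (Sym2 V)} (h : A.Sublist B)
    (hc : ∀ e ∈ B, 0 ≤ c e) : (A.map c).sum ≤ (B.map c).sum := by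
  refine (h.map c).sum_le_sum ?_
  simpa using hc

lemma sum_map_nonneg {c : Sym2 V → ℝ} {A : List (Sym2 V)} (hc : ∀ e ∈ A, 0 ≤ c e) :
    0 ≤ (A.map c).sum :=
  List.sum_nonneg (by simpa using hc)

lemma connTime_nonneg {c : Sym2 V → ℝ} {L : List (Sym2 V)} (hc : ∀ e ∈ L, 0 ≤ c e) (u v : V) :
    0 ≤ connTime c L u v :=
  sum_map_nonneg fun e he => hc e (List.mem_of_mem_take he)

lemma totalCost_nonneg {r : ℕ} {c : Sym2 V → ℝ} {w : Fin r → ℝ} (hw : ∀ i, 0 < w i)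
    (pair : Fin r → V × V) {L : List (Sym2 V)} (hc : ∀ e ∈ L, 0 ≤ c e) :
    0 ≤ totalCost c w pair L :=
  Finset.sum_nonneg fun i _ => mul_nonneg (hw i).le (connTime_nonneg hc _ _)

namespace Dominates

lemma reachable {T : Set V} {c' c : Sym2 V → ℝ} {L' L : List (Sym2 V)}
    (h : Dominates T c' c L' L) {u v : V} (hu : u ∈ T) (hv : v ∈ T)
    (huv : (listGraph L).Reachable u v) : (listGraph L').Reachable u v := by
  obtain ⟨B, hB, -, hr⟩ := h L List.prefix_rfl
  exact reachable_mono hB.subset (hr u hu v hv huv)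

lemma connTime_le {T : Set V} {c' c : Sym2 V → ℝ} {L' L : List (Sym2 V)}
    (h : Dominates T c' c L' L) (hc : ∀ e ∈ L', 0 ≤ c' e) {u v : V} (hu : u ∈ T) (hv : v ∈ T)
    (huv : (listGraph L).Reachable u v) : connTime c' L' u v ≤ connTime c L u v := by
  have hne : {k : ℕ | (fromEdgeSet {e | e ∈ L.take k}).Reachable u v}.Nonempty :=
    ⟨L.length, by simpa using huv⟩
  obtain ⟨B, hB, hsum, hr⟩ := h _ ⟨_, List.take_append_drop _ L⟩
  have hk : (listGraph (L'.take B.length)).Reachable u v := by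
    rw [← List.prefix_iff_eq_take.1 hB]
    exact hr u hu v hv (Nat.sInf_mem hne)
  refine le_trans ?_ hsum
  refine sum_map_le_of_sublist ?_ fun e he => hc e (hB.subset he)
  rw [List.prefix_iff_eq_take.1 hB]
  exact (List.take_prefix_take_left (Nat.sInf_le hk)).sublist

lemma totalCost_le {T : Set V} {c' c : Sym2 V → ℝ} {L' L : List (Sym2 V)} {r : ℕ}
    {w : Fin r → ℝ} {pair : Fin r → V × V} (h : Dominates T c' c L' L)
    (hc : ∀ e ∈ L', 0 ≤ c' e) (hw : ∀ i, 0 < w i)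
    (hT : ∀ i, (pair i).1 ∈ T ∧ (pair i).2 ∈ T)
    (hL : ∀ i, (listGraph L).Reachable (pair i).1 (pair i).2) :
    totalCost c' w pair L' ≤ totalCost c w pair L :=
  Finset.sum_le_sum fun i _ =>
    mul_le_mul_of_nonneg_left (h.connTime_le hc (hT i).1 (hT i).2 (hL i)) (hw i).le

end Dominates

/-- Replacing each edge of `L` by a list of edges of `s` that is no longer and connects its
endpoints yields a dominating ordering of `s`. -/
lemma exists_ordering_dominates {s : Set (Sym2 V)} (hs : s.Finite) {c' c : Sym2 V → ℝ}
    (hc : ∀ e ∈ s, 0 ≤ c' e) (L : List (Sym2 V))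
    (hL : ∀ e ∈ L, ∃ P : List (Sym2 V), (∀ x ∈ P, x ∈ s) ∧ (P.map c').sum ≤ c e ∧
      ∀ x y, e = s(x, y) → (listGraph P).Reachable x y) :
    ∃ M, IsOrdering M s ∧ Dominates Set.univ c' c M L := by
  classical
  obtain ⟨M, hnd, hMs, -, -, hdom⟩ : ∃ M : List (Sym2 V), M.Nodup ∧ (∀ x ∈ M, x ∈ s) ∧
      (M.map c').sum ≤ (L.map c).sum ∧
      (∀ u v, (listGraph L).Reachable u v → (listGraph M).Reachable u v) ∧
      Dominates Set.univ c' c M L := by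
    induction L using List.reverseRecOn with
    | nil =>
      refine ⟨[], by simp, by simp, by simp, fun u v h => h, fun A hA => ⟨A, hA, ?_⟩⟩
      rw [List.prefix_nil.1 hA]
      simp
    | append_singleton L e ih =>
      obtain ⟨M, hnd, hMs, hsum, hreach, hdom⟩ := ih fun x hx => hL x (by simp [hx])
      obtain ⟨P, hPs, hPsum, hP⟩ := hL e (by simp)
      set Q := P.dedup.filter (· ∉ M) with hQ
      have hQP : Q.Sublist P := List.filter_sublist.trans (List.dedup_sublist P)
      have hPQ : P ⊆ M ++ Q := fun x hx => by
        by_cases hxM : x ∈ M <;> simp [hQ, hx, hxM]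
      have hQsum : ((M ++ Q).map c').sum ≤ ((L ++ [e]).map c).sum := by
        have := sum_map_le_of_sublist (c := c') hQP fun x hx => hc x (hPs x hx)
        simp only [List.map_append, List.sum_append, List.map_cons, List.map_nil,
          List.sum_singleton]
        linarith
      have hreach' : ∀ u v, (listGraph (L ++ [e])).Reachable u v →
          (listGraph (M ++ Q)).Reachable u v := fun u v huv => by
        refine reachable_map id (fun x y _ hxy => ?_) huv
        rcases List.mem_append.1 hxy with h | h
        · exact reachable_mono (List.subset_append_left _ _) (hreach _ _ (reachable_of_mem h))
        · exact reachable_mono hPQ (hP x y (List.mem_singleton.1 h).symm)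
      refine ⟨M ++ Q, ?_, ?_, hQsum, hreach', fun A hA => ?_⟩
      · refine List.Nodup.append hnd ((List.nodup_dedup P).filter _) fun x hx hx' => ?_
        simp [hQ, hx] at hx'
      · intro x hx
        rcases List.mem_append.1 hx with h | h
        · exact hMs x h
        · exact hPs x (hQP.subset h)
      · rcases List.prefix_concat_iff.1 hA with rfl | hA
        · exact ⟨M ++ Q, List.prefix_rfl, hQsum, fun u _ v _ => hreach' u v⟩
        · obtain ⟨B, hB, h⟩ := hdom A hA
          exact ⟨B, hB.trans (List.prefix_append _ _), h⟩
  refine ⟨M ++ hs.toFinset.toList.filter (· ∉ M), ⟨?_, fun e => ?_⟩, fun A hA => ?_⟩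
  · refine List.Nodup.append hnd ((Finset.nodup_toList _).filter _) fun x hx hx' => ?_
    simp [hx] at hx'
  · by_cases he : e ∈ M
    · simp [he, hMs e he]
    · simp [he]
  · obtain ⟨B, hB, h⟩ := hdom A hA
    exact ⟨B, hB.trans (List.prefix_append _ _), h⟩

/-- Extending a list of edges of `s` to an ordering of `s`. -/
lemma exists_ordering_dominates_of_subset {s : Set (Sym2 V)} (hs : s.Finite) {c : Sym2 V → ℝ}
    (hc : ∀ e ∈ s, 0 ≤ c e) (L : List (Sym2 V)) (hL : ∀ e ∈ L, e ∈ s) :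
    ∃ M, IsOrdering M s ∧ Dominates Set.univ c c M L :=
  exists_ordering_dominates hs hc L fun e he =>
    ⟨[e], by simpa using hL e he, by simp, fun x y h => reachable_of_mem (by simp [h])⟩

lemma dominates_delete {T : Set V} {c : Sym2 V → ℝ} {X Y : List (Sym2 V)} {e : Sym2 V}
    (he : 0 ≤ c e) (f : V → V) (hfT : ∀ u ∈ T, f u = u)
    (hf : ∀ x y, s(x, y) ∈ X ++ Y → f x = x ∧ f y = y)
    (hfe : ∀ x y, s(x, y) = e → (listGraph X).Reachable (f x) (f y)) :
    Dominates T c c (X ++ Y) (X ++ e :: Y) := by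
  intro A hA
  rcases prefix_append_cons hA with h | ⟨Z, hZ, rfl⟩
  · exact ⟨A, h.trans (List.prefix_append _ _), le_rfl, fun u _ v _ h => h⟩
  · refine ⟨X ++ Z, (List.prefix_append_right_inj _).2 hZ, ?_, fun u hu v hv huv => ?_⟩
    · simp only [List.map_append, List.sum_append, List.map_cons, List.sum_cons]
      linarith
    · rw [← hfT u hu, ← hfT v hv]
      refine reachable_map f (fun x y _ hxy => ?_) huv
      have hcases : s(x, y) ∈ X ++ Z ∨ s(x, y) = e := by
        simp only [List.mem_append, List.mem_cons] at hxy ⊢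
        tauto
      rcases hcases with h | h
      · have h' : s(x, y) ∈ X ++ Y := by
          rcases List.mem_append.1 h with h | h
          · simp [h]
          · simp [hZ.subset h]
        rw [(hf x y h').1, (hf x y h').2]
        exact reachable_of_mem h
      · exact reachable_mono (List.subset_append_left _ _) (hfe x y h)

lemma dominates_shortcut [DecidableEq V] {T : Set V} {c : Sym2 V → ℝ} {X Y Z : List (Sym2 V)}
    {v a b : V} (hva : 0 ≤ c s(v, a)) (htri : c s(a, b) ≤ c s(v, a) + c s(v, b)) (hvT : v ∉ T)
    (hb : b ≠ v)
    (hv : ∀ e ∈ X ++ Y ++ Z, v ∉ e) :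
    Dominates T c c (X ++ (Y ++ s(a, b) :: Z)) (X ++ s(v, a) :: (Y ++ s(v, b) :: Z)) := by
  set f : V → V := Function.update id v a with hf
  have hfv : f v = a := by simp [hf]
  have hfne : ∀ x, x ≠ v → f x = x := fun x hx => by simp [hf, hx]
  have hfT : ∀ u ∈ T, f u = u := fun u hu => hfne u fun h => hvT (h ▸ hu)
  have hfe : ∀ x y, s(x, y) ∈ X ++ Y ++ Z → f x = x ∧ f y = y := fun x y h =>
    ⟨hfne x fun hx => hv _ h (by simp [hx]), hfne y fun hy => hv _ h (by simp [hy])⟩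
  have hfa : f a = a := by
    by_cases h : a = v
    · rw [h, hfv, h]
    · exact hfne a h
  have hloop : ∀ x y, s(x, y) = s(v, a) → f x = f y := by
    intro x y h
    rcases Sym2.eq_iff.1 h with ⟨rfl, rfl⟩ | ⟨rfl, rfl⟩ <;> simp [hfv, hfa]
  intro A hA
  rcases prefix_append_cons hA with h | ⟨A', hA', rfl⟩
  · exact ⟨A, h.trans (List.prefix_append _ _), le_rfl, fun u _ v _ h => h⟩
  rcases prefix_append_cons hA' with h | ⟨Z', hZ', rfl⟩
  · refine ⟨X ++ A', (List.prefix_append_right_inj _).2 (h.trans (List.prefix_append _ _)), ?_,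
      fun p hp q hq hpq => ?_⟩
    · simp only [List.map_append, List.sum_append, List.map_cons, List.sum_cons]
      linarith
    · rw [← hfT p hp, ← hfT q hq]
      refine reachable_map f (fun x y _ hxy => ?_) hpq
      have hcases : s(x, y) ∈ X ++ A' ∨ s(x, y) = s(v, a) := by
        simp only [List.mem_append, List.mem_cons] at hxy ⊢
        tauto
      rcases hcases with h1 | h1
      · have h2 : s(x, y) ∈ X ++ Y ++ Z := by
          rcases List.mem_append.1 h1 with h1 | h1
          · simp [h1]
          · simp [h.subset h1]
        rw [(hfe x y h2).1, (hfe x y h2).2]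
        exact reachable_of_mem h1
      · rw [hloop x y h1]
  · refine ⟨X ++ (Y ++ s(a, b) :: Z'), ?_, ?_, fun p hp q hq hpq => ?_⟩
    · simp only [List.prefix_append_right_inj, List.cons_prefix_cons, true_and]
      exact hZ'
    · simp only [List.map_append, List.sum_append, List.map_cons, List.sum_cons]
      linarith
    · rw [← hfT p hp, ← hfT q hq]
      refine reachable_map f (fun x y _ hxy => ?_) hpq
      have hcases : s(x, y) ∈ X ++ Y ++ Z' ∨ s(x, y) = s(v, a) ∨ s(x, y) = s(v, b) := by
        simp only [List.mem_append, List.mem_cons] at hxy ⊢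
        tauto
      rcases hcases with h1 | h1 | h1
      · have h2 : s(x, y) ∈ X ++ Y ++ Z := by
          rcases List.mem_append.1 h1 with h1 | h1
          · exact List.mem_append_left _ h1
          · exact List.mem_append_right _ (hZ'.subset h1)
        rw [(hfe x y h2).1, (hfe x y h2).2]
        refine reachable_of_mem ?_
        simp only [List.mem_append, List.mem_cons] at h1 ⊢
        tauto
      · rw [hloop x y h1]
      · have hab : (listGraph (X ++ (Y ++ s(a, b) :: Z'))).Reachable a b :=
          reachable_of_mem (by simp)
        rcases Sym2.eq_iff.1 h1 with ⟨rfl, rfl⟩ | ⟨rfl, rfl⟩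
        · rw [hfv, hfne _ hb]
          exact hab
        · rw [hfv, hfne _ hb]
          exact hab.symm

section MetricClosure

variable {G : SimpleGraph V} {c : Sym2 V → ℝ}

lemma walk_length_nonneg (hc : ∀ e ∈ G.edgeSet, 0 < c e) {u v : V} (p : G.Walk u v) :
    0 ≤ (p.edges.map c).sum :=
  sum_map_nonneg fun e he => (hc e (p.edges_subset_edgeSet he)).le

lemma mcLength_nonneg (hc : ∀ e ∈ G.edgeSet, 0 < c e) (e : Sym2 V) : 0 ≤ mcLength G c e :=
  Real.sInf_nonneg (by
    rintro x ⟨u, v, -, p, rfl⟩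
    exact walk_length_nonneg hc p)

lemma mcLength_le_walk (hc : ∀ e ∈ G.edgeSet, 0 < c e) {u v : V} (p : G.Walk u v) :
    mcLength G c s(u, v) ≤ (p.edges.map c).sum :=
  csInf_le ⟨0, by
    rintro x ⟨u, v, -, p, rfl⟩
    exact walk_length_nonneg hc p⟩ ⟨u, v, rfl, p, rfl⟩

lemma mcLength_le (hc : ∀ e ∈ G.edgeSet, 0 < c e) {e : Sym2 V} (he : e ∈ G.edgeSet) :
    mcLength G c e ≤ c e := by
  induction e with
  | _ u v => simpa using mcLength_le_walk hc (Walk.cons (G.mem_edgeSet.1 he) Walk.nil)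

lemma exists_walk_le_mcLength [Finite V] (hconn : G.Connected)
    (hc : ∀ e ∈ G.edgeSet, 0 < c e) (u v : V) :
    ∃ p : G.Walk u v, (p.edges.map c).sum ≤ mcLength G c s(u, v) := by
  classical
  have : Fintype V := Fintype.ofFinite V
  have hfin : {l : List (Sym2 V) | l.Nodup}.Finite :=
    Finite.of_fintype {l : List (Sym2 V) // l.Nodup}
  set S : Set (List (Sym2 V)) := {l | l.Nodup ∧ ∃ p : G.Walk u v, p.edges = l}
  have hS : S.Finite := hfin.subset fun l hl => hl.1
  have hbyp : ∀ p : G.Walk u v, p.bypass.edges ∈ S := fun p =>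
    ⟨p.bypass_isPath.isTrail.edges_nodup, p.bypass, rfl⟩
  obtain ⟨l, ⟨-, p, rfl⟩, hmin⟩ := Set.exists_min_image S (fun l => (l.map c).sum) hS
    ⟨_, hbyp (hconn u v).some⟩
  have hle : ∀ q : G.Walk u v, (p.edges.map c).sum ≤ (q.edges.map c).sum := fun q =>
    (hmin _ (hbyp q)).trans (sum_map_le_of_sublist q.edges_bypass_sublist_edges fun e he =>
      (hc e (q.edges_subset_edgeSet he)).le)
  refine ⟨p, le_csInf ⟨_, u, v, rfl, p, rfl⟩ ?_⟩
  rintro x ⟨u', v', h, q, rfl⟩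
  rcases Sym2.eq_iff.1 h with ⟨rfl, rfl⟩ | ⟨rfl, rfl⟩
  · exact hle q
  · simpa using hle q.reverse

lemma mcLength_triangle [Finite V] (hconn : G.Connected) (hc : ∀ e ∈ G.edgeSet, 0 < c e)
    (v a b : V) : mcLength G c s(a, b) ≤ mcLength G c s(v, a) + mcLength G c s(v, b) := by
  obtain ⟨p, hp⟩ := exists_walk_le_mcLength hconn hc v a
  obtain ⟨q, hq⟩ := exists_walk_le_mcLength hconn hc v b
  have := mcLength_le_walk hc (p.reverse.append q)
  simp only [Walk.edges_append, Walk.edges_reverse, List.map_append, List.map_reverse,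
    List.sum_append, List.sum_reverse] at this
  linarith

lemma reachable_edges {u v : V} (p : G.Walk u v) : (listGraph p.edges).Reachable u v := by
  induction p with
  | nil => exact Reachable.refl _
  | cons h p ih =>
    refine (reachable_of_mem ?_).trans (reachable_mono ?_ ih) <;> simp

end MetricClosure

lemma isAcyclic_and_nodup {L : List (Sym2 V)}
    (h : ∀ X Y a b, L = X ++ s(a, b) :: Y → ¬ (listGraph X).Reachable a b) :
    (listGraph L).IsAcyclic ∧ L.Nodup := by
  induction L using List.reverseRecOn with
  | nil => simp [listGraph]
  | append_singleton L e ih =>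
    have ih := ih fun X Y a b hL => h X (Y ++ [e]) a b (by simp [hL])
    induction e with
    | _ a b =>
      have hab := h L [] a b rfl
      refine ⟨?_, ?_⟩
      · have := ih.1.sup_edge_of_not_reachable hab
        have heq : listGraph (L ++ [s(a, b)]) = listGraph L ⊔ edge a b := by
          rw [listGraph, listGraph, edge, ← fromEdgeSet_union]
          congr 1
          ext x
          simp [or_comm]
        rwa [heq]
      · refine List.Nodup.append ih.2 (List.nodup_singleton _) ?_
        rw [List.disjoint_singleton]
        exact fun hmem => hab (reachable_of_mem hmem)

lemma exists_first {α : Type} {p : α → Prop} {L : List α} (h : ∃ x ∈ L, p x) :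
    ∃ X e Y, L = X ++ e :: Y ∧ (∀ x ∈ X, ¬ p x) ∧ p e := by
  induction L with
  | nil => simp at h
  | cons a L ih =>
    by_cases ha : p a
    · exact ⟨[], a, L, rfl, by simp, ha⟩
    · obtain ⟨X, e, Y, rfl, hX, he⟩ := ih (by simpa [ha] using h)
      exact ⟨a :: X, e, Y, rfl, by simpa [ha] using hX, he⟩

/-- A nonempty forest has more vertices than edges. -/
lemma length_lt_card [DecidableEq V] {L : List (Sym2 V)} (hac : (listGraph L).IsAcyclic)
    (hnd : L.Nodup) (hdiag : ∀ e ∈ L, ¬ e.IsDiag) {S : Finset V} (hS : S.Nonempty)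
    (hLS : ∀ e ∈ L, ∀ v ∈ e, v ∈ S) : L.length < S.card := by
  classical
  have : Nonempty S := hS.to_subtype
  obtain ⟨F, -, hF, hle⟩ : ∃ F : SimpleGraph S, F ≤ ⊤ ∧ F.IsTree ∧
      (listGraph L).induce (S : Set V) ≤ F := by
    obtain ⟨F, h1, h2, h3⟩ := connected_top.exists_isTree_le_of_le_of_isAcyclic
      (le_top : (listGraph L).induce (S : Set V) ≤ ⊤) (hac.induce _)
    exact ⟨F, by assumption, by assumption, by assumption⟩
  have hcard := hF.card_edgeFinset
  rw [Fintype.card_coe] at hcard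
  have hsub : L.toFinset ⊆ F.edgeFinset.image (Sym2.map Subtype.val) := by
    intro e he
    rw [List.mem_toFinset] at he
    induction e with
    | _ x y =>
      have hx := hLS _ he x (by simp)
      have hy := hLS _ he y (by simp)
      refine Finset.mem_image.2 ⟨s(⟨x, hx⟩, ⟨y, hy⟩), ?_, rfl⟩
      rw [mem_edgeFinset, mem_edgeSet]
      exact hle ((fromEdgeSet_adj _).2 ⟨he, hdiag _ he⟩)
  have := (Finset.card_le_card hsub).trans Finset.card_image_le
  rw [List.toFinset_card_of_nodup hnd] at this
  omega

lemma sum_countP_mem [DecidableEq V] {L : List (Sym2 V)} {S : Finset V}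
    (hdiag : ∀ e ∈ L, ¬ e.IsDiag) (hLS : ∀ e ∈ L, ∀ v ∈ e, v ∈ S) :
    ∑ v ∈ S, L.countP (v ∈ ·) = 2 * L.length := by
  induction L with
  | nil => simp
  | cons e L ih =>
    have ih := ih (fun x hx => hdiag x (by simp [hx])) fun x hx => hLS x (by simp [hx])
    simp only [List.countP_cons, Finset.sum_add_distrib, ih, List.length_cons]
    have : ∑ v ∈ S, (if decide (v ∈ e) = true then 1 else 0) = 2 := by
      simp only [decide_eq_true_eq, Finset.sum_boole, Nat.cast_id]
      have hd := hdiag e (by simp)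
      have hm := hLS e (by simp)
      induction e with
      | _ x y =>
        have : S.filter (· ∈ s(x, y)) = {x, y} := by
          ext v
          simp only [Finset.mem_filter, Sym2.mem_iff, Finset.mem_insert, Finset.mem_singleton]
          refine ⟨fun h => h.2, fun h => ⟨hm v (Sym2.mem_iff.2 h), h⟩⟩
        rw [this, Finset.card_pair hd]
    omega

/-- In a nonempty forest whose vertices outside `T` all have degree at least three, those
vertices number at most `|T| - 2`. -/
lemma ncard_nonterminal_le [Fintype V] [DecidableEq V] {L : List (Sym2 V)}
    (hac : (listGraph L).IsAcyclic) (hnd : L.Nodup) (hdiag : ∀ e ∈ L, ¬ e.IsDiag)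
    (hne : L ≠ []) (T : Finset V)
    (hdeg : ∀ v ∉ T, (∃ e ∈ L, v ∈ e) → 3 ≤ L.countP (v ∈ ·)) :
    {v : V | (∃ e ∈ L, v ∈ e) ∧ v ∉ T}.ncard + 2 ≤ T.card := by
  classical
  set S : Finset V := Finset.univ.filter fun v => ∃ e ∈ L, v ∈ e with hSdef
  have hLS : ∀ e ∈ L, ∀ v ∈ e, v ∈ S := fun e he v hv => by
    simp only [hSdef, Finset.mem_filter, Finset.mem_univ, true_and]
    exact ⟨e, he, hv⟩
  have hS : S.Nonempty := by
    obtain ⟨e, he⟩ := List.exists_mem_of_ne_nil L hne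
    induction e with
    | _ x y => exact ⟨x, hLS _ he x (by simp)⟩
  have h1 := length_lt_card hac hnd hdiag hS hLS
  have h2 := sum_countP_mem hdiag hLS
  have hN : {v : V | (∃ e ∈ L, v ∈ e) ∧ v ∉ T} = ↑(S.filter (· ∉ T)) := by
    ext v
    simp [hSdef]
  rw [hN, Set.ncard_coe_finset]
  have h3 := Finset.sum_filter_add_sum_filter_not S (· ∈ T) fun v => L.countP (v ∈ ·)
  have h4 := Finset.card_filter_add_card_filter_not (s := S) (· ∈ T)
  have h5 : (S.filter (· ∈ T)).card * 1 ≤ ∑ v ∈ S.filter (· ∈ T), L.countP (v ∈ ·) := by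
    refine Finset.card_nsmul_le_sum _ _ 1 fun v hv => ?_
    obtain ⟨e, he, hve⟩ := (Finset.mem_filter.1 (Finset.mem_filter.1 hv).1).2
    exact List.countP_pos_iff.2 ⟨e, he, by simpa using hve⟩
  have h6 : (S.filter (· ∉ T)).card * 3 ≤ ∑ v ∈ S.filter (· ∉ T), L.countP (v ∈ ·) := by
    refine Finset.card_nsmul_le_sum _ _ 3 fun v hv => ?_
    exact hdeg v (Finset.mem_filter.1 hv).2 (Finset.mem_filter.1 (Finset.mem_filter.1 hv).1).2
  have h7 : (S.filter (· ∈ T)).card ≤ T.card :=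
    Finset.card_le_card fun v hv => (Finset.mem_filter.1 hv).2
  omega

/-- A list of edges of minimal length among those it is dominated by has degree at least three
at every nonterminal vertex. -/
lemma three_le_countP [DecidableEq V] {T : Set V} {c : Sym2 V → ℝ} {L : List (Sym2 V)}
    (hc : ∀ e, 0 ≤ c e) (htri : ∀ v a b, c s(a, b) ≤ c s(v, a) + c s(v, b))
    (hdiag : ∀ e ∈ L, ¬ e.IsDiag)
    (hreach : ∀ X Y a b, L = X ++ s(a, b) :: Y → ¬ (listGraph X).Reachable a b)
    (hmin : ∀ L', (∀ e ∈ L', ¬ e.IsDiag) → Dominates T c c L' L → L.length ≤ L'.length)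
    {v : V} (hv : v ∉ T) (hvL : ∃ e ∈ L, v ∈ e) : 3 ≤ L.countP (v ∈ ·) := by
  obtain ⟨X, e, Y, rfl, hX, he⟩ := exists_first hvL
  obtain ⟨a, rfl⟩ := he
  by_cases hY : ∃ e ∈ Y, v ∈ e
  · obtain ⟨Y, e, Z, rfl, hYv, he⟩ := exists_first hY
    obtain ⟨b, rfl⟩ := he
    by_cases hZ : ∃ e ∈ Z, v ∈ e
    · have : 0 < Z.countP (v ∈ ·) := List.countP_pos_iff.2 (by simpa using hZ)
      simp
      omega
    · push Not at hZ
      have hab : a ≠ b := by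
        rintro rfl
        exact hreach (X ++ s(v, a) :: Y) Z v a (by simp) (reachable_of_mem (by simp))
      have hvb : b ≠ v := fun h => hdiag s(v, b) (by simp) (by simp [h])
      have := hmin (X ++ (Y ++ s(a, b) :: Z)) (fun e he => ?_)
        (dominates_shortcut (hc _) (htri v a b) hv hvb fun e he => ?_)
      · simp at this
      · by_cases h : e = s(a, b)
        · simpa [h] using hab
        · refine hdiag e ?_
          simp only [List.mem_append, List.mem_cons] at he ⊢
          tauto
      · simp only [List.mem_append] at he
        rcases he with (h | h) | h
        exacts [hX e h, hYv e h, hZ e h]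
  · push Not at hY
    have hne : ∀ e ∈ X ++ Y, v ∉ e := fun e he => by
      rcases List.mem_append.1 he with h | h
      exacts [hX e h, hY e h]
    have hva : a ≠ v := fun h => hdiag s(v, a) (by simp) (by simp [h])
    have := hmin (X ++ Y) (fun e he => hdiag e ?_)
      (dominates_delete (hc _) (Function.update id v a) (fun u hu => ?_) (fun x y hxy => ?_)
        fun x y hxy => ?_)
    · simp at this
    · simp only [List.mem_append, List.mem_cons] at he ⊢
      tauto
    · have : u ≠ v := fun h => hv (h ▸ hu)
      simp [this]
    · have hx : x ≠ v := fun h => hne _ hxy (by simp [h])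
      have hy : y ≠ v := fun h => hne _ hxy (by simp [h])
      simp [hx, hy]
    · rcases Sym2.eq_iff.1 hxy with ⟨rfl, rfl⟩ | ⟨rfl, rfl⟩ <;> simp [hva]

lemma exists_optimal_ordering {α : Type} [Finite α] (s : Set α) (cost : List α → ℝ) :
    ∃ L, IsOrdering L s ∧ ∀ M, IsOrdering M s → cost L ≤ cost M := by
  classical
  have : Fintype α := Fintype.ofFinite α
  have hfin : {L : List α | L.Nodup}.Finite :=
    Finite.of_fintype {L : List α // L.Nodup}
  exact Set.exists_min_image {L | IsOrdering L s} cost (hfin.subset fun L hL => hL.1)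
    ⟨s.toFinite.toFinset.toList, Finset.nodup_toList _, by simp⟩

lemma sInf_ordering_eq {α : Type} {s : Set α} {cost : List α → ℝ} {L : List α}
    (hL : IsOrdering L s) (hmin : ∀ M, IsOrdering M s → cost L ≤ cost M) :
    sInf {x : ℝ | ∃ M, IsOrdering M s ∧ x = cost M} = cost L :=
  IsLeast.csInf_eq ⟨⟨L, hL, rfl⟩, by
    rintro x ⟨M, hM, rfl⟩
    exact hmin M hM⟩

end NetworkSchedule

open NetworkSchedule

/-- Corollary 2 / corR1: there is an acyclic edge set `Fh` of the metric
closure `Ĝ = ⊤` connecting every relevant pair, with at most `2r − 2` non-terminal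
vertices, whose optimal total weighted connection time equals the optimum over all linear
orderings of the full edge set of `Ĝ`, and this common value equals the optimum over all
linear orderings of the edge set of `G` (i.e. `Z*(G) = Z*(Ĝ)`). -/
theorem stmt12 (V : Type) [Fintype V] [DecidableEq V] (G : SimpleGraph V)
    (hconn : G.Connected) (c : Sym2 V → ℝ) (hc : ∀ e ∈ G.edgeSet, 0 < c e)
    (r : ℕ) (hr : 1 ≤ r)
    (pair : Fin r → V × V) (hpair : ∀ i, (pair i).1 ≠ (pair i).2)
    (w : Fin r → ℝ) (hw : ∀ i, 0 < w i) :
    ∃ Fh : Finset (Sym2 V),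
      ↑Fh ⊆ (⊤ : SimpleGraph V).edgeSet ∧
      (SimpleGraph.fromEdgeSet (↑Fh : Set (Sym2 V))).IsAcyclic ∧
      (∀ i, (SimpleGraph.fromEdgeSet (↑Fh : Set (Sym2 V))).Reachable
          (pair i).1 (pair i).2) ∧
      {v : V | (∃ e ∈ Fh, v ∈ e) ∧ ¬ ∃ i, v = (pair i).1 ∨ v = (pair i).2}.ncard
        ≤ 2 * r - 2 ∧
      sInf {x : ℝ | ∃ L : List (Sym2 V), IsOrdering L ↑Fh ∧
          x = totalCost (mcLength G c) w pair L}
        = sInf {x : ℝ | ∃ L : List (Sym2 V), IsOrdering L (⊤ : SimpleGraph V).edgeSet ∧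
            x = totalCost (mcLength G c) w pair L} ∧
      sInf {x : ℝ | ∃ L : List (Sym2 V), IsOrdering L (⊤ : SimpleGraph V).edgeSet ∧
          x = totalCost (mcLength G c) w pair L}
        = sInf {x : ℝ | ∃ L : List (Sym2 V), IsOrdering L G.edgeSet ∧
            x = totalCost c w pair L} := by
  classical
  set m := mcLength G c with hm
  have hm0 : ∀ e, 0 ≤ m e := mcLength_nonneg hc
  set T : Finset V := Finset.univ.image (fun i => (pair i).1) ∪
    Finset.univ.image (fun i => (pair i).2) with hT
  have hTmem : ∀ v, v ∈ T ↔ ∃ i, v = (pair i).1 ∨ v = (pair i).2 := fun v => by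
    simp only [hT, Finset.mem_union, Finset.mem_image, Finset.mem_univ, true_and, ← exists_or,
      eq_comm]
  have hpT : ∀ i, (pair i).1 ∈ (T : Set V) ∧ (pair i).2 ∈ (T : Set V) := fun i =>
    ⟨(hTmem _).2 ⟨i, Or.inl rfl⟩, (hTmem _).2 ⟨i, Or.inr rfl⟩⟩
  have hTcard : T.card ≤ 2 * r := by
    refine (Finset.card_union_le _ _).trans ?_
    have h1 := Finset.card_image_le (s := Finset.univ) (f := fun i => (pair i).1)
    have h2 := Finset.card_image_le (s := Finset.univ) (f := fun i => (pair i).2)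
    simp only [Finset.card_univ, Fintype.card_fin] at h1 h2
    omega
  have hord : ∀ H : SimpleGraph V, H.Connected → ∀ L, IsOrdering L H.edgeSet → ∀ u v,
      (listGraph L).Reachable u v := fun H hH L hL u v => by
    have : listGraph L = H := by
      rw [listGraph, show {e | e ∈ L} = H.edgeSet from Set.ext hL.2, SimpleGraph.fromEdgeSet_edgeSet]
    rw [this]
    exact hH u v
  have : Nonempty V := hconn.nonempty
  have htop := hord ⊤ SimpleGraph.connected_top
  obtain ⟨L₀, hL₀, hL₀min⟩ :=
    exists_optimal_ordering (⊤ : SimpleGraph V).edgeSet (totalCost m w pair)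
  obtain ⟨LG, hLG, hLGmin⟩ := exists_optimal_ordering G.edgeSet (totalCost c w pair)
  have htopInf := sInf_ordering_eq hL₀ hL₀min
  have hGInf := sInf_ordering_eq hLG hLGmin
  have hnotdiag : ∀ e : Sym2 V, e ∈ (⊤ : SimpleGraph V).edgeSet ↔ ¬ e.IsDiag := fun e => by simp
  obtain ⟨L, ⟨hLtop, hLreach, hLcost⟩, hLmin⟩ := (measure List.length).wf.has_min
    {L : List (Sym2 V) | (∀ e ∈ L, ¬ e.IsDiag) ∧
      (∀ i, (listGraph L).Reachable (pair i).1 (pair i).2) ∧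
      totalCost m w pair L ≤ totalCost m w pair L₀}
    ⟨L₀, fun e he => (hnotdiag e).1 ((hL₀.2 e).1 he), fun i => htop L₀ hL₀ _ _, le_rfl⟩
  have hmin : ∀ L', (∀ e ∈ L', ¬ e.IsDiag) → Dominates (T : Set V) m m L' L →
      L.length ≤ L'.length := fun L' hL' hd => not_lt.1 <| hLmin L' ⟨hL',
    fun i => hd.reachable (hpT i).1 (hpT i).2 (hLreach i),
    (hd.totalCost_le (fun e _ => hm0 e) hw hpT hLreach).trans hLcost⟩
  have hnreach : ∀ X Y a b, L = X ++ s(a, b) :: Y → ¬ (listGraph X).Reachable a b := by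
    rintro X Y a b rfl hab
    have := hmin (X ++ Y) (fun e he => hLtop e (by
        simp only [List.mem_append, List.mem_cons] at he ⊢
        tauto))
      (dominates_delete (hm0 _) id (fun _ _ => rfl) (fun _ _ _ => ⟨rfl, rfl⟩)
        fun x y hxy => by
          rcases Sym2.eq_iff.1 hxy with ⟨rfl, rfl⟩ | ⟨rfl, rfl⟩
          exacts [hab, hab.symm])
    simp at this
  obtain ⟨hac, hnd⟩ := isAcyclic_and_nodup hnreach
  have hLne : L ≠ [] := by
    rintro rfl
    have := hLreach ⟨0, hr⟩
    simp [listGraph] at this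
    exact hpair _ this
  have hcoe : (↑L.toFinset : Set (Sym2 V)) = {e | e ∈ L} := by simp
  have hLord : IsOrdering L (↑L.toFinset : Set (Sym2 V)) := ⟨hnd, by simp⟩
  have hFmin : ∀ M, IsOrdering M (↑L.toFinset : Set (Sym2 V)) →
      totalCost m w pair L₀ ≤ totalCost m w pair M := fun M hM => by
    obtain ⟨N, hN, hd⟩ := exists_ordering_dominates_of_subset
      (Set.toFinite (⊤ : SimpleGraph V).edgeSet) (fun e _ => hm0 e) M fun e he =>
        (hnotdiag e).2 (hLtop e (by simpa using (hM.2 e).1 he))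
    refine (hL₀min N hN).trans (hd.totalCost_le (fun e _ => hm0 e) hw (by simp) fun i => ?_)
    exact reachable_mono (fun e he => (hM.2 e).2 (by simpa using he)) (hLreach i)
  have hFInf := sInf_ordering_eq hLord fun M hM => hLcost.trans (hFmin M hM)
  refine ⟨L.toFinset, ?_, ?_, ?_, ?_, ?_, ?_⟩
  · intro e he
    exact (hnotdiag e).2 (hLtop e (by simpa using he))
  · rw [hcoe]
    exact hac
  · rw [hcoe]
    exact hLreach
  · have := ncard_nonterminal_le hac hnd hLtop hLne T fun v hv hvL =>
      three_le_countP hm0 (mcLength_triangle hconn hc) hLtop hnreach hmin (by simpa using hv) hvL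
    simp only [hTmem] at this
    simp only [List.mem_toFinset]
    omega
  · rw [hFInf, htopInf]
    exact le_antisymm hLcost (hFmin L hLord)
  · rw [htopInf, hGInf]
    refine le_antisymm ?_ ?_
    · obtain ⟨N, hN, hd⟩ := exists_ordering_dominates (c := c) (c' := m)
        (Set.toFinite (⊤ : SimpleGraph V).edgeSet) (fun e _ => hm0 e) LG fun e he => by
          have heG := (hLG.2 e).1 he
          exact ⟨[e], by simpa using G.not_isDiag_of_mem_edgeSet heG,
            by simpa using mcLength_le hc heG, fun x y h => reachable_of_mem (by simp [h])⟩
      exact (hL₀min N hN).trans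
        (hd.totalCost_le (fun e _ => hm0 e) hw (by simp) fun i => hord G hconn LG hLG _ _)
    · have hc0 : ∀ e ∈ G.edgeSet, 0 ≤ c e := fun e he => (hc e he).le
      obtain ⟨N, hN, hd⟩ := exists_ordering_dominates (c := m) (c' := c)
        (Set.toFinite G.edgeSet) hc0 L₀ fun e _ => by
          induction e with
          | _ u v =>
            obtain ⟨p, hp⟩ := exists_walk_le_mcLength hconn hc u v
            refine ⟨p.edges, fun x hx => p.edges_subset_edgeSet hx, hp, fun x y h => ?_⟩
            rcases Sym2.eq_iff.1 h with ⟨rfl, rfl⟩ | ⟨rfl, rfl⟩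
            exacts [reachable_edges p, (reachable_edges p).symm]
      exact (hLGmin N hN).trans
        (hd.totalCost_le (fun e he => hc0 e ((hN.2 e).1 he)) hw (by simp) fun i => htop L₀ hL₀ _ _)
end
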